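/- arXiv:2102.02373 — 2 statements merged into one kernel-verified Lean document; each statement's English description precedes it below -/
import Mathlib

section
/- Let d ∈ ℤ be primary in ℤ[i] (d ≡ 1 mod 4 suffices) and n ∈ ℤ[i] primary with gcd(d, n) = 1 and both coprime to 2. Then g(dn) = conj((d²/n)₄) · g(d) · g(n), where g(m) = g(1, m) is the quartic Gauss sum. -/
noncomputable section
open Complex
open scoped ComplexConjugate Classical

/-- `n` is primary: `n ≡ 1 mod (1+i)^3` in `ℤ[i]`. -/
def IsPrimary (n : GaussianInt) : Prop := (⟨1, 1⟩ : GaussianInt) ^ 3 ∣ n - 1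

/-- The additive character `ẽ(z) = exp(2πi (z/(2i) - z̄/(2i)))` on `ℚ(i)`. -/
def echar (z : ℂ) : ℂ :=
  Complex.exp (2 * Real.pi * I * (z / (2 * I) - (conj z) / (2 * I)))

/-- The quartic residue symbol `(a/ϖ)₄` at a Gaussian prime `ϖ`: the unique fourth root of
unity `ζ ∈ {1, -1, i, -i}` with `a^((N(ϖ)-1)/4) ≡ ζ (mod ϖ)`, or `0` if `ϖ ∣ a`. -/
def quarticSymbolPrime (a ϖ : GaussianInt) : GaussianInt :=
  if ϖ ∣ a then 0
  else if h : ∃ ζ : GaussianInt,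
      ζ ∈ ({1, -1, ⟨0, 1⟩, ⟨0, -1⟩} : Set GaussianInt) ∧
      ϖ ∣ a ^ (((Zsqrtd.norm ϖ).natAbs - 1) / 4) - ζ
    then h.choose else 0

/-- The quartic residue symbol `(a/n)₄` for odd `n ∈ ℤ[i]`, extended multiplicatively from
Gaussian primes, with value `1` when `n` is a unit. -/
def quarticSymbol (a n : GaussianInt) : GaussianInt :=
  if n = 0 then 0
  else ((UniqueFactorizationMonoid.factors n).map fun ϖ => quarticSymbolPrime a ϖ).prod

/-- The twisted quartic Gauss sum `g(k,n) = Σ_{x mod n} (x/n)₄ ẽ(kx/n)`. -/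
def gaussSumK (k n : GaussianInt) : ℂ :=
  ∑ᶠ x : GaussianInt ⧸ Ideal.span {n},
    GaussianInt.toComplex (quarticSymbol x.out n) *
      echar (GaussianInt.toComplex k * GaussianInt.toComplex x.out / GaussianInt.toComplex n)

/-- The quartic Gauss sum `g(n) = g(1,n)`. -/
def quarticGaussSum (n : GaussianInt) : ℂ := gaussSumK 1 n

namespace GaussianInt

/-- The basis `1, i` of the Gaussian integers over `ℤ`. -/
def basisOneI : Module.Basis (Fin 2) ℤ GaussianInt :=
  Module.Basis.ofEquivFun
    { toFun := fun x => ![x.re, x.im]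
      invFun := fun v => ⟨v 0, v 1⟩
      map_add' := fun x y => by ext i; fin_cases i <;> simp
      map_smul' := fun c x => by ext i; fin_cases i <;> simp
      left_inv := fun x => by simp
      right_inv := fun v => by ext i; fin_cases i <;> simp }

instance : Module.Free ℤ GaussianInt := Module.Free.of_basis basisOneI

instance : Module.Finite ℤ GaussianInt := Module.Finite.of_basis basisOneI

lemma algebraNorm_eq_norm (x : GaussianInt) : Algebra.norm ℤ x = Zsqrtd.norm x := by
  rw [Algebra.norm_eq_matrix_det basisOneI, Matrix.det_fin_two]
  simp [Algebra.leftMulMatrix_eq_repr_mul, basisOneI, Zsqrtd.norm_def]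

lemma finite_quotient_span {n : GaussianInt} (hn : n ≠ 0) :
    Finite (GaussianInt ⧸ Ideal.span {n}) :=
  Ideal.finiteQuotientOfFreeOfNeBot _ (by simpa using hn)

lemma card_quotient_span (n : GaussianInt) :
    Nat.card (GaussianInt ⧸ Ideal.span {n}) = (Zsqrtd.norm n).natAbs := by
  rw [← algebraNorm_eq_norm, ← Ideal.absNorm_span_singleton]
  rfl

lemma pow_four_eq_one_iff {x : GaussianInt} :
    x ^ 4 = 1 ↔ x ∈ ({1, -1, ⟨0, 1⟩, ⟨0, -1⟩} : Set GaussianInt) := by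
  constructor
  · intro h
    have h' : (x - 1) * (x + 1) * (x - ⟨0, 1⟩) * (x - ⟨0, -1⟩) = 0 := by
      have hi : (⟨0, 1⟩ : GaussianInt) * ⟨0, -1⟩ = 1 := by decide
      have hi' : (⟨0, 1⟩ : GaussianInt) + ⟨0, -1⟩ = 0 := by decide
      linear_combination h - (x ^ 2 - 1) * x * hi' + (x ^ 2 - 1) * hi
    simp only [mul_eq_zero, sub_eq_zero, add_eq_zero_iff_eq_neg] at h'
    simpa [or_assoc] using h'
  · rintro (rfl | rfl | rfl | rfl) <;> decide

lemma sub_dvd_two {x y : GaussianInt} (hx : x = 0 ∨ x ^ 4 = 1) (hy : y = 0 ∨ y ^ 4 = 1)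
    (hxy : x ≠ y) : x - y ∣ 2 := by
  rw [pow_four_eq_one_iff] at hx hy
  rcases hx with rfl | rfl | rfl | rfl | rfl <;> rcases hy with rfl | rfl | rfl | rfl | rfl <;>
    first
    | exact absurd rfl hxy
    | exact ⟨1, by decide⟩
    | exact ⟨-1, by decide⟩
    | exact ⟨2, by decide⟩
    | exact ⟨-2, by decide⟩
    | exact ⟨⟨0, 1⟩, by decide⟩
    | exact ⟨⟨0, -1⟩, by decide⟩
    | exact ⟨⟨0, 2⟩, by decide⟩
    | exact ⟨⟨0, -2⟩, by decide⟩
    | exact ⟨⟨1, 1⟩, by decide⟩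
    | exact ⟨⟨1, -1⟩, by decide⟩
    | exact ⟨⟨-1, 1⟩, by decide⟩
    | exact ⟨⟨-1, -1⟩, by decide⟩

lemma eq_of_dvd_sub {ϖ x y : GaussianInt} (h2 : ¬ ϖ ∣ 2) (hx : x = 0 ∨ x ^ 4 = 1)
    (hy : y = 0 ∨ y ^ 4 = 1) (h : ϖ ∣ x - y) : x = y := by
  by_contra hxy
  exact h2 (h.trans (sub_dvd_two hx hy hxy))

lemma norm_mod_four {ϖ : GaussianInt} (hϖ : Prime ϖ) (h2 : ¬ ϖ ∣ 2) :
    (Zsqrtd.norm ϖ).natAbs % 4 = 1 := by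
  have key : ¬ (⟨1, 1⟩ : GaussianInt) ∣ ϖ := by
    intro h
    have hu : ¬ IsUnit (⟨1, 1⟩ : GaussianInt) := by
      rw [← Zsqrtd.norm_eq_one_iff]; decide
    have := ((hϖ.irreducible.dvd_iff).mp h).resolve_left hu
    exact h2 (this.dvd.trans ⟨⟨1, -1⟩, by decide⟩)
  have hpar : (ϖ.re + ϖ.im) % 2 = 1 := by
    by_contra h
    apply key
    refine ⟨⟨(ϖ.re + ϖ.im) / 2, (ϖ.im - ϖ.re) / 2⟩, ?_⟩
    ext <;> simp <;> omega
  have hn : Zsqrtd.norm ϖ % 4 = 1 := by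
    rw [Zsqrtd.norm_def]
    rcases Int.even_or_odd' ϖ.re with ⟨a, ha | ha⟩ <;>
      rcases Int.even_or_odd' ϖ.im with ⟨b, hb | hb⟩ <;> rw [ha, hb] at hpar ⊢ <;>
      first
      | (exfalso; omega)
      | (ring_nf; omega)
  have := abs_natCast_norm ϖ
  omega

lemma four_mul_norm_div {ϖ : GaussianInt} (hϖ : Prime ϖ) (h2 : ¬ ϖ ∣ 2) :
    4 * (((Zsqrtd.norm ϖ).natAbs - 1) / 4) = (Zsqrtd.norm ϖ).natAbs - 1 := by
  have := norm_mod_four hϖ h2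
  omega

lemma norm_div_pos {ϖ : GaussianInt} (hϖ : Prime ϖ) (h2 : ¬ ϖ ∣ 2) :
    0 < ((Zsqrtd.norm ϖ).natAbs - 1) / 4 := by
  have := norm_mod_four hϖ h2
  have h1 : (Zsqrtd.norm ϖ).natAbs ≠ 1 := fun h => hϖ.not_isUnit (Zsqrtd.norm_eq_one_iff.mp h)
  omega

lemma dvd_pow_norm_sub_one {ϖ a : GaussianInt} (hϖ : Prime ϖ) (ha : ¬ ϖ ∣ a) :
    ϖ ∣ a ^ ((Zsqrtd.norm ϖ).natAbs - 1) - 1 := by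
  have hmax : (Ideal.span {ϖ}).IsMaximal :=
    PrincipalIdealRing.isMaximal_of_irreducible hϖ.irreducible
  let := Ideal.Quotient.field (Ideal.span {ϖ})
  have := finite_quotient_span hϖ.ne_zero
  let := Fintype.ofFinite (GaussianInt ⧸ Ideal.span {ϖ})
  have h0 : Ideal.Quotient.mk (Ideal.span {ϖ}) a ≠ 0 := by
    rwa [Ne, Ideal.Quotient.eq_zero_iff_dvd]
  have := FiniteField.pow_card_sub_one_eq_one _ h0
  rw [← Nat.card_eq_fintype_card, card_quotient_span] at this
  rw [← Ideal.Quotient.eq_zero_iff_dvd]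
  simp [this]

lemma exists_pow_four_eq_one {ϖ a : GaussianInt} (hϖ : Prime ϖ) (h2 : ¬ ϖ ∣ 2) (ha : ¬ ϖ ∣ a) :
    ∃ ζ : GaussianInt, ζ ∈ ({1, -1, ⟨0, 1⟩, ⟨0, -1⟩} : Set GaussianInt) ∧
      ϖ ∣ a ^ (((Zsqrtd.norm ϖ).natAbs - 1) / 4) - ζ := by
  have h := dvd_pow_norm_sub_one hϖ ha
  rw [← four_mul_norm_div hϖ h2, mul_comm, pow_mul] at h
  generalize a ^ (((Zsqrtd.norm ϖ).natAbs - 1) / 4) = x at h ⊢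
  have h' : x ^ 4 - 1 = (x - 1) * (x - -1) * (x - ⟨0, 1⟩) * (x - ⟨0, -1⟩) := by
    have hi : (⟨0, 1⟩ : GaussianInt) * ⟨0, -1⟩ = 1 := by decide
    have hi' : (⟨0, 1⟩ : GaussianInt) + ⟨0, -1⟩ = 0 := by decide
    linear_combination (x ^ 2 - 1) * x * hi' - (x ^ 2 - 1) * hi
  rw [h', hϖ.dvd_mul, hϖ.dvd_mul, hϖ.dvd_mul] at h
  rcases h with ((h | h) | h) | h
  exacts [⟨1, by simp, h⟩, ⟨-1, by simp, h⟩, ⟨_, by simp, h⟩, ⟨_, by simp, h⟩]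

lemma quarticSymbolPrime_spec {ϖ : GaussianInt} (hϖ : Prime ϖ) (h2 : ¬ ϖ ∣ 2)
    {a : GaussianInt} (ha : ¬ ϖ ∣ a) : quarticSymbolPrime a ϖ ^ 4 = 1 ∧
      ϖ ∣ a ^ (((Zsqrtd.norm ϖ).natAbs - 1) / 4) - quarticSymbolPrime a ϖ := by
  have h := exists_pow_four_eq_one hϖ h2 ha
  rw [quarticSymbolPrime, if_neg ha, dif_pos h, pow_four_eq_one_iff]
  exact h.choose_spec

lemma quarticSymbolPrime_eq_zero {ϖ a : GaussianInt} (ha : ϖ ∣ a) : quarticSymbolPrime a ϖ = 0 :=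
  if_pos ha

lemma quarticSymbolPrime_zero_or {ϖ : GaussianInt} (hϖ : Prime ϖ) (h2 : ¬ ϖ ∣ 2)
    (a : GaussianInt) : quarticSymbolPrime a ϖ = 0 ∨ quarticSymbolPrime a ϖ ^ 4 = 1 := by
  by_cases ha : ϖ ∣ a
  · exact Or.inl (quarticSymbolPrime_eq_zero ha)
  · exact Or.inr (quarticSymbolPrime_spec hϖ h2 ha).1

lemma dvd_pow_sub_quarticSymbolPrime {ϖ : GaussianInt} (hϖ : Prime ϖ) (h2 : ¬ ϖ ∣ 2)
    (a : GaussianInt) :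
    ϖ ∣ a ^ (((Zsqrtd.norm ϖ).natAbs - 1) / 4) - quarticSymbolPrime a ϖ := by
  by_cases ha : ϖ ∣ a
  · rw [quarticSymbolPrime_eq_zero ha, sub_zero]
    exact dvd_pow ha (norm_div_pos hϖ h2).ne'
  · exact (quarticSymbolPrime_spec hϖ h2 ha).2

lemma quarticSymbolPrime_eq_iff {ϖ : GaussianInt} (hϖ : Prime ϖ) (h2 : ¬ ϖ ∣ 2)
    {a x : GaussianInt} (hx : x = 0 ∨ x ^ 4 = 1) :
    quarticSymbolPrime a ϖ = x ↔ ϖ ∣ a ^ (((Zsqrtd.norm ϖ).natAbs - 1) / 4) - x := by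
  constructor
  · rintro rfl
    exact dvd_pow_sub_quarticSymbolPrime hϖ h2 a
  · intro h
    refine eq_of_dvd_sub h2 (quarticSymbolPrime_zero_or hϖ h2 a) hx ?_
    have := dvd_sub h (dvd_pow_sub_quarticSymbolPrime hϖ h2 a)
    rwa [sub_sub_sub_cancel_left] at this

lemma mul_zero_or {x y : GaussianInt} (hx : x = 0 ∨ x ^ 4 = 1) (hy : y = 0 ∨ y ^ 4 = 1) :
    x * y = 0 ∨ (x * y) ^ 4 = 1 := by
  rcases hx with rfl | hx
  · simp
  rcases hy with rfl | hy
  · simp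
  · exact Or.inr (by rw [mul_pow, hx, hy, one_mul])

lemma quarticSymbolPrime_mul {ϖ : GaussianInt} (hϖ : Prime ϖ) (h2 : ¬ ϖ ∣ 2) (a b : GaussianInt) :
    quarticSymbolPrime (a * b) ϖ = quarticSymbolPrime a ϖ * quarticSymbolPrime b ϖ := by
  rw [quarticSymbolPrime_eq_iff hϖ h2 (mul_zero_or (quarticSymbolPrime_zero_or hϖ h2 a)
    (quarticSymbolPrime_zero_or hϖ h2 b)), mul_pow]
  convert dvd_add
    ((dvd_pow_sub_quarticSymbolPrime hϖ h2 a).mul_right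
      (b ^ (((Zsqrtd.norm ϖ).natAbs - 1) / 4)))
    ((dvd_pow_sub_quarticSymbolPrime hϖ h2 b).mul_left (quarticSymbolPrime a ϖ)) using 1
  ring

lemma quarticSymbolPrime_one {ϖ : GaussianInt} (hϖ : Prime ϖ) (h2 : ¬ ϖ ∣ 2) :
    quarticSymbolPrime 1 ϖ = 1 := by
  rw [quarticSymbolPrime_eq_iff hϖ h2 (by simp)]
  simp

lemma quarticSymbolPrime_congr {ϖ : GaussianInt} (hϖ : Prime ϖ) (h2 : ¬ ϖ ∣ 2)
    {a b : GaussianInt} (h : ϖ ∣ a - b) : quarticSymbolPrime a ϖ = quarticSymbolPrime b ϖ := by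
  rw [quarticSymbolPrime_eq_iff hϖ h2 (quarticSymbolPrime_zero_or hϖ h2 b)]
  have := dvd_add (h.trans (sub_dvd_pow_sub_pow a b (((Zsqrtd.norm ϖ).natAbs - 1) / 4)))
    (dvd_pow_sub_quarticSymbolPrime hϖ h2 b)
  rwa [sub_add_sub_cancel] at this

lemma natAbs_norm_eq_of_associated {x y : GaussianInt} (h : Associated x y) :
    (Zsqrtd.norm x).natAbs = (Zsqrtd.norm y).natAbs := by
  obtain ⟨u, rfl⟩ := h
  rw [Zsqrtd.norm_mul, Int.natAbs_mul, Zsqrtd.norm_eq_one_iff.mpr u.isUnit, mul_one]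

lemma quarticSymbolPrime_associated {ϖ ϖ' : GaussianInt} (h : Associated ϖ ϖ')
    (a : GaussianInt) : quarticSymbolPrime a ϖ = quarticSymbolPrime a ϖ' := by
  unfold quarticSymbolPrime
  simp only [h.dvd_iff_dvd_left, natAbs_norm_eq_of_associated h]

lemma star_dvd_star {x y : GaussianInt} : star x ∣ star y ↔ x ∣ y := by
  constructor
  · rintro ⟨c, hc⟩
    exact ⟨star c, by rw [← star_star y, hc, star_mul', star_star]⟩
  · rintro ⟨c, rfl⟩
    exact ⟨star c, by rw [star_mul']⟩

lemma prime_star {ϖ : GaussianInt} (hϖ : Prime ϖ) : Prime (star ϖ) :=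
  (MulEquiv.prime_iff (starRingAut : GaussianInt ≃+* GaussianInt)).mpr hϖ

lemma quarticSymbolPrime_star {ϖ : GaussianInt} (hϖ : Prime ϖ) (h2 : ¬ ϖ ∣ 2)
    (a : GaussianInt) :
    quarticSymbolPrime (star a) (star ϖ) = star (quarticSymbolPrime a ϖ) := by
  have h2' : ¬ star ϖ ∣ 2 := by
    rwa [← star_dvd_star, star_star, star_ofNat]
  rw [quarticSymbolPrime_eq_iff (prime_star hϖ) h2', Zsqrtd.norm_conj, ← star_pow, ← star_sub,
    star_dvd_star]
  · exact dvd_pow_sub_quarticSymbolPrime hϖ h2 a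
  · rcases quarticSymbolPrime_zero_or hϖ h2 a with h | h
    · simp [h]
    · exact Or.inr (by rw [← star_pow, h, star_one])

lemma quarticSymbol_unit (a : GaussianInt) {n : GaussianInt} (hn : IsUnit n) :
    quarticSymbol a n = 1 := by
  rw [quarticSymbol, if_neg hn.ne_zero]
  obtain ⟨u, rfl⟩ := hn
  rw [show UniqueFactorizationMonoid.factors (u : GaussianInt) = 0 from ?_]
  · simp
  · rw [Multiset.eq_zero_iff_forall_notMem]
    intro p hp
    exact (UniqueFactorizationMonoid.prime_of_factor p hp).not_isUnit
      (isUnit_of_dvd_unit (UniqueFactorizationMonoid.dvd_of_mem_factors hp) u.isUnit)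

lemma prod_map_quarticSymbolPrime_congr {s t : Multiset GaussianInt}
    (h : Multiset.Rel Associated s t) (a : GaussianInt) :
    (s.map fun ϖ => quarticSymbolPrime a ϖ).prod = (t.map fun ϖ => quarticSymbolPrime a ϖ).prod := by
  have := Multiset.rel_map_left (f := fun ϖ => quarticSymbolPrime a ϖ) (r := Eq) (s := s)
    (t := t.map fun ϖ => quarticSymbolPrime a ϖ)
  rw [← Multiset.rel_eq.mp (this.mpr ?_)]
  rw [Multiset.rel_map_right]
  exact h.mono fun x _ y _ hxy => quarticSymbolPrime_associated hxy a

lemma quarticSymbol_mul_right (a : GaussianInt) {m n : GaussianInt} (hm : m ≠ 0) (hn : n ≠ 0) :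
    quarticSymbol a (m * n) = quarticSymbol a m * quarticSymbol a n := by
  rw [quarticSymbol, quarticSymbol, quarticSymbol, if_neg hm, if_neg hn,
    if_neg (mul_ne_zero hm hn), prod_map_quarticSymbolPrime_congr
      (UniqueFactorizationMonoid.factors_mul hm hn), Multiset.map_add, Multiset.prod_add]

lemma quarticSymbol_prime (a : GaussianInt) {ϖ : GaussianInt} (hϖ : Prime ϖ) :
    quarticSymbol a ϖ = quarticSymbolPrime a ϖ := by
  rw [quarticSymbol, if_neg hϖ.ne_zero, prod_map_quarticSymbolPrime_congr (t := {ϖ})]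
  · simp
  · refine UniqueFactorizationMonoid.factors_unique
      (fun x hx => (UniqueFactorizationMonoid.prime_of_factor x hx).irreducible)
      (fun x hx => by rw [Multiset.mem_singleton.mp hx]; exact hϖ.irreducible) ?_
    rw [Multiset.prod_singleton]
    exact UniqueFactorizationMonoid.factors_prod hϖ.ne_zero

lemma not_dvd_two_of_isCoprime {ϖ n : GaussianInt} (hϖ : Prime ϖ) (hn : IsCoprime n 2)
    (h : ϖ ∣ n) : ¬ ϖ ∣ 2 :=
  fun h' => hϖ.not_isUnit (hn.isUnit_of_dvd' h h')

lemma ne_zero_of_isCoprime_two {n : GaussianInt} (hn : IsCoprime n 2) : n ≠ 0 := by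
  rintro rfl
  rw [isCoprime_zero_left, ← Zsqrtd.norm_eq_one_iff] at hn
  revert hn
  decide

lemma quarticSymbol_mul_left {n : GaussianInt} (hn : IsCoprime n 2) (a b : GaussianInt) :
    quarticSymbol (a * b) n = quarticSymbol a n * quarticSymbol b n := by
  rw [quarticSymbol, quarticSymbol, quarticSymbol, if_neg (ne_zero_of_isCoprime_two hn),
    if_neg (ne_zero_of_isCoprime_two hn), if_neg (ne_zero_of_isCoprime_two hn),
    ← Multiset.prod_map_mul]
  congr 1
  refine Multiset.map_congr rfl fun ϖ hϖ => ?_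
  have hp := UniqueFactorizationMonoid.prime_of_factor ϖ hϖ
  exact quarticSymbolPrime_mul hp (not_dvd_two_of_isCoprime hp hn
    (UniqueFactorizationMonoid.dvd_of_mem_factors hϖ)) a b

lemma quarticSymbol_congr {n : GaussianInt} (hn : IsCoprime n 2) {a b : GaussianInt}
    (h : n ∣ a - b) : quarticSymbol a n = quarticSymbol b n := by
  rw [quarticSymbol, quarticSymbol, if_neg (ne_zero_of_isCoprime_two hn),
    if_neg (ne_zero_of_isCoprime_two hn)]
  congr 1
  refine Multiset.map_congr rfl fun ϖ hϖ => ?_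
  have hp := UniqueFactorizationMonoid.prime_of_factor ϖ hϖ
  have hd := UniqueFactorizationMonoid.dvd_of_mem_factors hϖ
  exact quarticSymbolPrime_congr hp (not_dvd_two_of_isCoprime hp hn hd) (hd.trans h)

lemma quarticSymbol_pow_four {a n : GaussianInt} (hn : IsCoprime n 2) (h : IsCoprime a n) :
    quarticSymbol a n ^ 4 = 1 := by
  rw [quarticSymbol, if_neg (ne_zero_of_isCoprime_two hn), ← Multiset.prod_map_pow]
  refine Multiset.prod_eq_one fun x hx => ?_
  obtain ⟨ϖ, hϖ, rfl⟩ := Multiset.mem_map.mp hx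
  have hp := UniqueFactorizationMonoid.prime_of_factor ϖ hϖ
  have hd := UniqueFactorizationMonoid.dvd_of_mem_factors hϖ
  exact (quarticSymbolPrime_spec hp (not_dvd_two_of_isCoprime hp hn hd)
    fun h' => hp.not_isUnit (h.isUnit_of_dvd' h' hd)).1

end GaussianInt

section FiniteFieldSums

universe u v

lemma isUnit_natCast_of_ringChar_ne {F K : Type*} [Field F] [Field K]
    (h : ringChar K ≠ ringChar F) {q : ℕ}
    [hq : Fact q.Prime] [CharP K q] : IsUnit (q : F) := by
  rw [isUnit_iff_ne_zero]
  intro H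
  exact h ((ringChar.eq K q).trans (CharP.ringChar_of_prime_eq_zero hq.out H).symm)

variable {F : Type u} {K : Type v} [Field F] [Fintype F] [Field K]

lemma gaussSum_pow_four {χ : MulChar F K} (hχ : χ ^ 2 ≠ 1) (hχ4 : χ ^ 4 = 1)
    {ψ : AddChar F K} (hψ : ψ.IsPrimitive) :
    gaussSum χ ψ ^ 4 = Fintype.card F * jacobiSum χ χ ^ 2 := by
  have hquad : (χ ^ 2).IsQuadratic := by
    intro a
    by_cases ha : IsUnit a
    · right
      rw [← sq_eq_one_iff, ← MulChar.pow_apply' _ two_ne_zero, ← pow_mul, hχ4,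
        MulChar.one_apply ha]
    · exact Or.inl (MulChar.map_nonunit _ ha)
  have h1 : (χ ^ 2) (-1) = 1 := by
    rw [MulChar.pow_apply' _ two_ne_zero, ← map_pow, neg_one_sq, map_one]
  have h2 := gaussSum_sq hχ hquad hψ
  have h3 := jacobiSum_mul_nontrivial (χ := χ) (φ := χ) (by rwa [← sq]) ψ
  rw [← sq] at h3
  rw [h1, one_mul] at h2
  rw [← h2, ← mul_pow, h3]
  ring

lemma card_ne_zero_of_ringChar_ne (h : ringChar K ≠ ringChar F) : (Fintype.card F : K) ≠ 0 := by
  obtain ⟨n, hp, hc⟩ := FiniteField.card F (ringChar F)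
  intro H
  rw [hc, Nat.cast_pow, pow_eq_zero_iff n.ne_zero] at H
  exact h (CharP.ringChar_of_prime_eq_zero hp H)

lemma gaussSum_pow_char (h : ringChar K ≠ ringChar F) {q : ℕ} [hq : Fact q.Prime] [CharP K q]
    (χ : MulChar F K) (ψ : AddChar F K) :
    gaussSum χ ψ ^ q = (χ ^ q)⁻¹ q * gaussSum (χ ^ q) ψ := by
  rw [gaussSum_frob, AddChar.pow_mulShift]
  obtain ⟨u, hu⟩ := isUnit_natCast_of_ringChar_ne h (q := q)
  rw [← hu, gaussSum_mulShift_eq]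

lemma card_mul_jacobiSum_sq_pow_of_mod_four_eq_one_aux (h : ringChar K ≠ ringChar F) {q : ℕ}
    [hq : Fact q.Prime] [CharP K q] (hq4 : q % 4 = 1) {χ : MulChar F K} (hχ : χ ^ 2 ≠ 1)
    (hχ4 : χ ^ 4 = 1) {ψ : AddChar F K} (hψ : ψ.IsPrimitive) :
    (Fintype.card F * jacobiSum χ χ ^ 2) ^ ((q - 1) / 4) * χ q = 1 := by
  have hχ1 : χ ≠ 1 := by rintro rfl; simp at hχ
  have hχq : χ ^ q = χ := by
    conv_lhs => rw [← Nat.div_add_mod q 4, hq4, pow_add, pow_mul, hχ4, one_pow, one_mul, pow_one]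
  have h1 := gaussSum_pow_char h (q := q) χ ψ
  have hu := isUnit_natCast_of_ringChar_ne h (q := q)
  have hinv : χ⁻¹ (q : F) * χ q = 1 := by
    rw [← MulChar.mul_apply, inv_mul_cancel, MulChar.one_apply hu]
  rw [hχq] at h1
  rw [← gaussSum_pow_four hχ hχ4 hψ, ← pow_mul, show 4 * ((q - 1) / 4) = q - 1 by omega]
  have hg := gaussSum_ne_zero_of_nontrivial (card_ne_zero_of_ringChar_ne h) hχ1 hψ
  apply mul_left_cancel₀ hg
  rw [← mul_assoc, ← pow_succ', Nat.sub_add_cancel hq.out.one_le, h1, mul_right_comm, hinv]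
  ring

lemma card_mul_jacobiSum_sq_pow_of_mod_four_eq_three_aux (h : ringChar K ≠ ringChar F) {q : ℕ}
    [hq : Fact q.Prime] [CharP K q] (hq4 : q % 4 = 3) {χ : MulChar F K} (hχ : χ ^ 2 ≠ 1)
    (hχ4 : χ ^ 4 = 1) {ψ : AddChar F K} (hψ : ψ.IsPrimitive) :
    (Fintype.card F * jacobiSum χ χ ^ 2) ^ ((q + 1) / 4) = χ (-q) * Fintype.card F := by
  have hχ1 : χ ≠ 1 := by rintro rfl; simp at hχ
  have hχq : χ ^ q = χ⁻¹ := by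
    rw [eq_inv_iff_mul_eq_one, ← pow_succ, show q + 1 = 4 * ((q + 1) / 4) by omega, pow_mul, hχ4,
      one_pow]
  have h1 := gaussSum_pow_char h (q := q) χ ψ
  rw [hχq, inv_inv] at h1
  have h2 := mul_gaussSum_inv_eq_gaussSum χ⁻¹ ψ
  have h3 := gaussSum_mul_gaussSum_eq_card hχ1 hψ
  have h4 : χ⁻¹ (-1 : F) = χ (-1) := by
    rw [MulChar.inv_apply', inv_neg, inv_one]
  have h5 : χ (-(q : F)) = χ (-1) * χ q := by rw [← map_mul, neg_one_mul]
  rw [← gaussSum_pow_four hχ hχ4 hψ, ← pow_mul, show 4 * ((q + 1) / 4) = q + 1 by omega, pow_succ,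
    h1, ← h2, h4, ← h3, h5]
  ring

lemma exists_isPrimitive_extension (h : ringChar K ≠ ringChar F) :
    ∃ (L : Type v) (_ : Field L) (_ : K →+* L) (ψ : AddChar F L),
      ψ.IsPrimitive ∧ ringChar L = ringChar K :=
  let ψ := AddChar.FiniteField.primitiveChar F K h
  ⟨CyclotomicField ψ.n K, inferInstance, algebraMap _ _, ψ.char, ψ.prim,
    (Algebra.ringChar_eq K _).symm⟩

lemma card_mul_jacobiSum_sq_pow_of_mod_four_eq_one (h : ringChar K ≠ ringChar F) {q : ℕ}
    [hq : Fact q.Prime] [CharP K q] (hq4 : q % 4 = 1) {χ : MulChar F K} (hχ : χ ^ 2 ≠ 1)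
    (hχ4 : χ ^ 4 = 1) : (Fintype.card F * jacobiSum χ χ ^ 2) ^ ((q - 1) / 4) * χ q = 1 := by
  obtain ⟨L, _, f, ψ, hψ, hL⟩ := exists_isPrimitive_extension h
  have : CharP L q := charP_of_injective_ringHom f.injective q
  have hne : χ.ringHomComp f ^ 2 ≠ 1 := by
    rwa [MulChar.ringHomComp_pow, MulChar.ringHomComp_ne_one_iff f.injective]
  have hone : χ.ringHomComp f ^ 4 = 1 := by
    rw [MulChar.ringHomComp_pow, hχ4, MulChar.ringHomComp_one]
  have := card_mul_jacobiSum_sq_pow_of_mod_four_eq_one_aux (hL ▸ h) hq4 hne hone hψ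
  rw [jacobiSum_ringHomComp] at this
  apply f.injective
  simpa using this

lemma card_mul_jacobiSum_sq_pow_of_mod_four_eq_three (h : ringChar K ≠ ringChar F) {q : ℕ}
    [hq : Fact q.Prime] [CharP K q] (hq4 : q % 4 = 3) {χ : MulChar F K} (hχ : χ ^ 2 ≠ 1)
    (hχ4 : χ ^ 4 = 1) :
    (Fintype.card F * jacobiSum χ χ ^ 2) ^ ((q + 1) / 4) = χ (-q) * Fintype.card F := by
  obtain ⟨L, _, f, ψ, hψ, hL⟩ := exists_isPrimitive_extension h
  have : CharP L q := charP_of_injective_ringHom f.injective q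
  have hne : χ.ringHomComp f ^ 2 ≠ 1 := by
    rwa [MulChar.ringHomComp_pow, MulChar.ringHomComp_ne_one_iff f.injective]
  have hone : χ.ringHomComp f ^ 4 = 1 := by
    rw [MulChar.ringHomComp_pow, hχ4, MulChar.ringHomComp_one]
  have := card_mul_jacobiSum_sq_pow_of_mod_four_eq_three_aux (hL ▸ h) hq4 hne hone hψ
  rw [jacobiSum_ringHomComp] at this
  apply f.injective
  simpa using this

lemma sum_pow_mul_one_sub_pow_eq_zero {k : ℕ} (hk : 2 * k < Fintype.card F - 1) :
    ∑ x : F, x ^ k * (1 - x) ^ k = 0 := by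
  have : ∀ x : F, x ^ k * (1 - x) ^ k =
      ∑ m ∈ Finset.range (k + 1), (-1) ^ m * (k.choose m : F) * x ^ (k + m) := by
    intro x
    rw [sub_eq_neg_add, add_pow, Finset.mul_sum]
    refine Finset.sum_congr rfl fun m _ => ?_
    rw [neg_pow, one_pow, pow_add]
    ring
  simp_rw [this]
  rw [Finset.sum_comm]
  refine Finset.sum_eq_zero fun m hm => ?_
  rw [← Finset.mul_sum, FiniteField.sum_pow_lt_card_sub_one, mul_zero]
  have := Finset.mem_range.mp hm
  omega

end FiniteFieldSums

namespace GaussianInt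

section QuarticChar

variable {F : Type*} [Field F] {ϖ : GaussianInt}

/-- The quartic residue character modulo a Gaussian prime `ϖ`, as a multiplicative character on
a model `F` of the residue field of `ϖ`. -/
def quarticChar (hϖ : Prime ϖ) (h2 : ¬ ϖ ∣ 2) (f : GaussianInt →+* F)
    (hf : Function.Surjective f) (hker : ∀ a, f a = 0 ↔ ϖ ∣ a) : MulChar F GaussianInt where
  toFun x := quarticSymbolPrime (Function.surjInv hf x) ϖ
  map_one' := by
    rw [← quarticSymbolPrime_one hϖ h2]
    apply quarticSymbolPrime_congr hϖ h2
    rw [← hker, map_sub, Function.surjInv_eq hf, map_one, sub_self]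
  map_mul' x y := by
    rw [← quarticSymbolPrime_mul hϖ h2]
    apply quarticSymbolPrime_congr hϖ h2
    rw [← hker, map_sub, map_mul]
    simp only [Function.surjInv_eq hf, sub_self]
  map_nonunit' x hx := by
    apply quarticSymbolPrime_eq_zero
    rw [← hker, Function.surjInv_eq hf]
    simpa using hx

variable (hϖ : Prime ϖ) (h2 : ¬ ϖ ∣ 2) (f : GaussianInt →+* F)
    (hf : Function.Surjective f) (hker : ∀ a, f a = 0 ↔ ϖ ∣ a)

lemma quarticChar_apply (a : GaussianInt) :
    quarticChar hϖ h2 f hf hker (f a) = quarticSymbolPrime a ϖ := by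
  apply quarticSymbolPrime_congr hϖ h2
  rw [← hker, map_sub, Function.surjInv_eq hf, sub_self]

lemma map_quarticChar (x : F) :
    f (quarticChar hϖ h2 f hf hker x) = x ^ (((Zsqrtd.norm ϖ).natAbs - 1) / 4) := by
  obtain ⟨a, rfl⟩ := hf x
  rw [quarticChar_apply, ← map_pow, eq_comm, ← sub_eq_zero, ← map_sub, hker]
  exact dvd_pow_sub_quarticSymbolPrime hϖ h2 a

lemma quarticChar_pow_four : quarticChar hϖ h2 f hf hker ^ 4 = 1 := by
  refine MulChar.ext fun x => ?_
  obtain ⟨a, ha⟩ := hf x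
  have hx : ¬ ϖ ∣ a := by
    rw [← hker, ha]
    exact x.ne_zero
  rw [MulChar.pow_apply_coe, ← ha, quarticChar_apply, (quarticSymbolPrime_spec hϖ h2 hx).1, ha,
    MulChar.one_apply_coe]

variable [Fintype F] (hcard : Fintype.card F = (Zsqrtd.norm ϖ).natAbs)

include hcard

lemma quarticChar_sq_ne_one : quarticChar hϖ h2 f hf hker ^ 2 ≠ 1 := by
  intro h
  have hk := norm_div_pos hϖ h2
  have h4 := four_mul_norm_div hϖ h2
  have key : ∀ x : Fˣ, x ^ (2 * (((Zsqrtd.norm ϖ).natAbs - 1) / 4)) = 1 := by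
    intro x
    have hx := congrArg f (congrArg (fun χ : MulChar F GaussianInt => χ x) h)
    simp only [MulChar.pow_apply_coe, map_pow, map_quarticChar, MulChar.one_apply_coe,
      map_one] at hx
    ext
    rw [mul_comm, pow_mul]
    simpa using hx
  have := Nat.le_of_dvd (by omega) ((FiniteField.forall_pow_eq_one_iff F _).mp key)
  omega

lemma quarticChar_ringHomComp_sq_ne_one {K : Type*} [Field K] {l : GaussianInt} (hl2 : ¬ l ∣ 2)
    (φ : GaussianInt →+* K) (hφ : ∀ a, φ a = 0 ↔ l ∣ a) :
    (quarticChar hϖ h2 f hf hker).ringHomComp φ ^ 2 ≠ 1 := by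
  intro h
  apply quarticChar_sq_ne_one hϖ h2 f hf hker hcard
  refine MulChar.ext fun x => ?_
  have h4 := congrArg (fun χ : MulChar F GaussianInt => χ x)
    (quarticChar_pow_four hϖ h2 f hf hker)
  have hx := congrArg (fun χ : MulChar F K => χ x) h
  simp only [MulChar.pow_apply_coe, MulChar.one_apply_coe, MulChar.ringHomComp_apply] at h4 hx ⊢
  refine eq_of_dvd_sub hl2 (Or.inr ?_) (by simp) ?_
  · rw [← pow_mul, mul_comm, pow_mul, h4, one_pow]
  · rw [← hφ, map_sub, map_pow, hx, map_one, sub_self]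

lemma dvd_jacobiSum_quarticChar :
    ϖ ∣ jacobiSum (quarticChar hϖ h2 f hf hker) (quarticChar hϖ h2 f hf hker) := by
  have hk := norm_div_pos hϖ h2
  have h4 := four_mul_norm_div hϖ h2
  rw [← hker, jacobiSum, map_sum]
  simp only [map_mul, map_quarticChar]
  exact sum_pow_mul_one_sub_pow_eq_zero (by omega)

lemma norm_jacobiSum_quarticChar :
    Zsqrtd.norm (jacobiSum (quarticChar hϖ h2 f hf hker) (quarticChar hϖ h2 f hf hker)) =
      Zsqrtd.norm ϖ := by
  set χ := quarticChar hϖ h2 f hf hker with hχ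
  have hsq : χ ^ 2 ≠ 1 := quarticChar_sq_ne_one hϖ h2 f hf hker hcard
  have hne : χ ≠ 1 := by
    intro h
    simp [h] at hsq
  have hinj := toComplex_injective
  have hC := (MulChar.ringHomComp_ne_one_iff hinj).mpr hne
  have hC2 : χ.ringHomComp toComplex * χ.ringHomComp toComplex ≠ 1 := by
    rw [← MulChar.ringHomComp_mul, ← sq]
    exact (MulChar.ringHomComp_ne_one_iff hinj).mpr hsq
  have hchar : ringChar ℂ ≠ ringChar F := by
    rw [ringChar.eq_zero]
    exact (CharP.ringChar_ne_zero_of_finite F).symm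
  have h := jacobiSum_mul_jacobiSum_inv hchar hC hC hC2
  have hstar : jacobiSum (χ.ringHomComp toComplex)⁻¹ (χ.ringHomComp toComplex)⁻¹ =
      conj (jacobiSum (χ.ringHomComp toComplex) (χ.ringHomComp toComplex)) := by
    simp only [jacobiSum, map_sum, map_mul, ← MulChar.star_apply', starRingEnd_apply]
  rw [hstar, jacobiSum_ringHomComp, Complex.mul_conj, ← intCast_complex_norm, hcard] at h
  have h' : ((Zsqrtd.norm (jacobiSum χ χ) : ℤ) : ℂ) = ((Zsqrtd.norm ϖ : ℤ) : ℂ) := by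
    rw [h, ← Int.cast_natCast, abs_natCast_norm]
  exact_mod_cast h'

lemma two_dvd_jacobiSum_quarticChar_add_one :
    2 ∣ jacobiSum (quarticChar hϖ h2 f hf hker) (quarticChar hϖ h2 f hf hker) + 1 := by
  have h4 := quarticChar_pow_four hϖ h2 f hf hker
  have hμ : IsPrimitiveRoot (⟨0, 1⟩ : GaussianInt) 4 := by
    refine IsPrimitiveRoot.mk_of_lt _ (by norm_num) (by decide) fun l h0 hl => ?_
    interval_cases l <;> decide
  obtain ⟨z, -, hz⟩ := exists_jacobiSum_eq_neg_one_add (by norm_num) h4 h4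
    (by rw [hcard, ← four_mul_norm_div hϖ h2]; exact dvd_mul_right _ _) hμ
  rw [hz]
  have : ((⟨0, 1⟩ : GaussianInt) - 1) ^ 2 = 2 * ⟨0, -1⟩ := by decide
  exact ⟨z * ⟨0, -1⟩, by rw [this]; ring⟩

lemma jacobiSum_quarticChar_sq (hodd : 2 ∣ ϖ - 1) :
    jacobiSum (quarticChar hϖ h2 f hf hker) (quarticChar hϖ h2 f hf hker) ^ 2 = ϖ ^ 2 := by
  obtain ⟨c, hc⟩ := dvd_jacobiSum_quarticChar hϖ h2 f hf hker hcard
  have hn := norm_jacobiSum_quarticChar hϖ h2 f hf hker hcard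
  have hJ := two_dvd_jacobiSum_quarticChar_add_one hϖ h2 f hf hker hcard
  rw [hc] at hn hJ ⊢
  have hϖ0 : Zsqrtd.norm ϖ ≠ 0 := by rw [Ne, norm_eq_zero]; exact hϖ.ne_zero
  rw [Zsqrtd.norm_mul, mul_eq_left₀ hϖ0] at hn
  have h2c : 2 ∣ c + 1 := by
    have : c + 1 = (ϖ * c + 1) - (ϖ - 1) * c := by ring
    rw [this]
    exact dvd_sub hJ (hodd.mul_right c)
  obtain ⟨e, he⟩ := h2c
  have him : c.im = 2 * e.im := by simpa using congrArg Zsqrtd.im he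
  rw [Zsqrtd.norm_def, him] at hn
  have hi : e.im = 0 := by nlinarith [mul_self_nonneg c.re, mul_self_nonneg e.im]
  have hc2 : c ^ 2 = 1 := by
    rw [hi] at hn him
    rw [sq]
    ext <;> simp [him]
    linarith
  rw [mul_pow, hc2, mul_one]

end QuarticChar

lemma exists_residueField {ϖ : GaussianInt} (hϖ : Prime ϖ) :
    ∃ (K : Type) (_ : Field K) (_ : Fintype K) (f : GaussianInt →+* K),
      Function.Surjective f ∧ (∀ a, f a = 0 ↔ ϖ ∣ a) ∧
        Fintype.card K = (Zsqrtd.norm ϖ).natAbs := by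
  have hmax : (Ideal.span {ϖ}).IsMaximal :=
    PrincipalIdealRing.isMaximal_of_irreducible hϖ.irreducible
  have := finite_quotient_span hϖ.ne_zero
  refine ⟨GaussianInt ⧸ Ideal.span {ϖ}, Ideal.Quotient.field _,
    @Fintype.ofFinite _ this,
    Ideal.Quotient.mk _, Ideal.Quotient.mk_surjective, fun a => ?_, ?_⟩
  · exact Ideal.Quotient.eq_zero_iff_dvd _ _
  · exact (@Nat.card_eq_fintype_card _ (_)).symm.trans (card_quotient_span ϖ)

lemma mul_star_eq_norm (x : GaussianInt) : x * star x = (Zsqrtd.norm x : GaussianInt) :=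
  (Zsqrtd.norm_eq_mul_conj x).symm

lemma mul_star_eq_one_of_pow_four {x : GaussianInt} (hx : x ^ 4 = 1) : x * star x = 1 := by
  rw [pow_four_eq_one_iff] at hx
  rcases hx with rfl | rfl | rfl | rfl <;> decide

lemma pow_char_eq_star {K : Type*} [Field K] (f : GaussianInt →+* K) {q : ℕ} [Fact q.Prime]
    [CharP K q] (hq4 : q % 4 = 3) (x : GaussianInt) : f x ^ q = f (star x) := by
  have hx : x = (x.re : GaussianInt) + (x.im : GaussianInt) * ⟨0, 1⟩ := by ext <;> simp
  have hsx : star x = (x.re : GaussianInt) + (x.im : GaussianInt) * ⟨0, -1⟩ := by ext <;> simp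
  have hi : (⟨0, 1⟩ : GaussianInt) ^ q = ⟨0, -1⟩ := by
    rw [← Nat.div_add_mod q 4, hq4, pow_add, pow_mul,
      show (⟨0, 1⟩ : GaussianInt) ^ 4 = 1 by decide, one_pow, one_mul]
    decide
  rw [hsx]
  conv_lhs => rw [hx]
  rw [map_add, map_mul, add_pow_char, mul_pow, ← map_pow f ⟨0, 1⟩, hi]
  simp only [← frobenius_def, map_intCast, map_add, map_mul]

lemma quarticSymbolPrime_of_mod_four_eq_three {ϖ : GaussianInt} (hϖ : Prime ϖ)
    (hodd : 2 ∣ ϖ - 1) {p : ℕ} (hp : p.Prime) (hnorm : (Zsqrtd.norm ϖ) = p) {q : ℕ}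
    (hq : q.Prime) (hq4 : q % 4 = 3) (hqp : Prime (q : GaussianInt))
    (hqϖ : ¬ (q : GaussianInt) ∣ ϖ) (hϖ2 : ¬ ϖ ∣ 2) (hq2 : ¬ (q : GaussianInt) ∣ 2) :
    quarticSymbolPrime ϖ q = quarticSymbolPrime (-q) ϖ := by
  have := Fact.mk hq
  obtain ⟨F, _, _, f, hf, hker, hcard⟩ := exists_residueField hϖ
  obtain ⟨K, _, _, φ, -, hkerφ, -⟩ := exists_residueField hqp
  have : CharP K q := by
    rw [CharP.charP_iff_prime_eq_zero hq, ← map_natCast φ, hkerφ]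
  have hcard' : Fintype.card F = p := by rw [hcard, hnorm, Int.natAbs_natCast]
  have hu : φ ϖ ≠ 0 := by rwa [Ne, hkerφ]
  have hpu : (p : K) = φ ϖ ^ (q + 1) := by
    rw [pow_succ', pow_char_eq_star φ hq4, ← map_mul, mul_star_eq_norm, hnorm]
    simp
  have hchar : ringChar K ≠ ringChar F := by
    rw [ringChar.eq_iff.mpr this, CharP.ringChar_of_prime_eq_zero hp
      (by rw [← hcard']; exact FiniteField.cast_card_eq_zero F)]
    rintro rfl
    rw [CharP.cast_eq_zero] at hpu
    exact pow_ne_zero _ hu hpu.symm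
  set χ := quarticChar hϖ hϖ2 f hf hker with hχ
  set m := q / 4 with hm
  have hqm : q = 4 * m + 3 := by omega
  have hsq : χ.ringHomComp φ ^ 2 ≠ 1 :=
    quarticChar_ringHomComp_sq_ne_one hϖ hϖ2 f hf hker hcard hq2 φ hkerφ
  have hone : χ.ringHomComp φ ^ 4 = 1 := by
    rw [MulChar.ringHomComp_pow, quarticChar_pow_four, MulChar.ringHomComp_one]
  have key := card_mul_jacobiSum_sq_pow_of_mod_four_eq_three hchar hq4 hsq hone
  rw [jacobiSum_ringHomComp, ← map_pow, jacobiSum_quarticChar_sq hϖ hϖ2 f hf hker hcard hodd,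
    hcard', hpu, MulChar.ringHomComp_apply,
    show (-(q : F)) = f (-q) by simp, quarticChar_apply] at key
  rw [quarticSymbolPrime_eq_iff hqp hq2 (quarticSymbolPrime_zero_or hϖ hϖ2 _), ← hkerφ, map_sub,
    map_pow, sub_eq_zero]
  apply mul_right_cancel₀ (pow_ne_zero (q + 1) hu)
  rw [← key, map_pow, ← pow_add, ← pow_add, ← pow_mul]
  congr 1
  rw [Zsqrtd.norm_natCast]
  have h1 : ((q : ℤ) * q).natAbs = q * q := by
    rw [← Int.natCast_mul, Int.natAbs_natCast]
  have h2 : (q * q - 1) / 4 = (4 * m + 2) * (m + 1) := by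
    have : q * q = 4 * ((4 * m + 2) * (m + 1)) + 1 := by rw [hqm]; ring
    omega
  rw [h1, h2, show (q + 1) / 4 = m + 1 by omega, hqm]
  ring

lemma quarticSymbolPrime_of_mod_four_eq_one {ϖ : GaussianInt} (hϖ : Prime ϖ)
    (hodd : 2 ∣ ϖ - 1) {p : ℕ} (hp : p.Prime) (hnorm : (Zsqrtd.norm ϖ) = p) {q : ℕ}
    (hq : q.Prime) (hq4 : q % 4 = 1) {l : GaussianInt} (hl : Prime l)
    (hlq : Zsqrtd.norm l = q) (hlϖ : ¬ l ∣ ϖ) (hlϖ' : ¬ l ∣ star ϖ)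
    (hϖ2 : ¬ ϖ ∣ 2) (hl2 : ¬ l ∣ 2) :
    quarticSymbolPrime q ϖ = quarticSymbolPrime ϖ l * quarticSymbolPrime ϖ (star l) := by
  have := Fact.mk hq
  obtain ⟨F, _, _, f, hf, hker, hcard⟩ := exists_residueField hϖ
  obtain ⟨K, _, _, φ, -, hkerφ, -⟩ := exists_residueField hl
  have : CharP K q := by
    rw [CharP.charP_iff_prime_eq_zero hq, ← map_natCast φ, hkerφ]
    exact ⟨star l, by rw [mul_star_eq_norm, hlq]; simp⟩
  have hcard' : Fintype.card F = p := by rw [hcard, hnorm, Int.natAbs_natCast]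
  have hpu : (p : K) = φ (ϖ * star ϖ) := by
    rw [mul_star_eq_norm, hnorm]
    simp
  have hchar : ringChar K ≠ ringChar F := by
    rw [ringChar.eq_iff.mpr this, CharP.ringChar_of_prime_eq_zero hp
      (by rw [← hcard']; exact FiniteField.cast_card_eq_zero F)]
    rintro rfl
    rw [CharP.cast_eq_zero, eq_comm, hkerφ] at hpu
    exact (hl.dvd_or_dvd hpu).elim hlϖ hlϖ'
  set χ := quarticChar hϖ hϖ2 f hf hker with hχ
  have hsq : χ.ringHomComp φ ^ 2 ≠ 1 :=
    quarticChar_ringHomComp_sq_ne_one hϖ hϖ2 f hf hker hcard hl2 φ hkerφ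
  have hone : χ.ringHomComp φ ^ 4 = 1 := by
    rw [MulChar.ringHomComp_pow, quarticChar_pow_four, MulChar.ringHomComp_one]
  have key := card_mul_jacobiSum_sq_pow_of_mod_four_eq_one hchar hq4 hsq hone
  rw [jacobiSum_ringHomComp, ← map_pow, jacobiSum_quarticChar_sq hϖ hϖ2 f hf hker hcard hodd,
    hcard', hpu, MulChar.ringHomComp_apply,
    show (q : F) = f q by simp, quarticChar_apply, ← map_mul, ← map_pow, ← map_mul] at key
  have hsymb : quarticSymbolPrime (ϖ * star ϖ * ϖ ^ 2) l * quarticSymbolPrime q ϖ = 1 := by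
    refine eq_of_dvd_sub hl2 (mul_zero_or (quarticSymbolPrime_zero_or hl hl2 _)
      (quarticSymbolPrime_zero_or hϖ hϖ2 _)) (by simp) ?_
    rw [← hkerφ, map_sub, map_one, sub_eq_zero, ← key, map_mul, map_mul]
    congr 1
    rw [eq_comm, ← sub_eq_zero, ← map_sub, hkerφ]
    have := dvd_pow_sub_quarticSymbolPrime hl hl2 (ϖ * star ϖ * ϖ ^ 2)
    rwa [hlq, Int.natAbs_natCast] at this
  have hl' : ¬ star l ∣ ϖ := by rwa [← star_dvd_star, star_star]
  have hl2' : ¬ star l ∣ 2 := by rwa [← star_dvd_star, star_star, star_ofNat]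
  have hs := (quarticSymbolPrime_spec hl hl2 hlϖ).1
  have ht := (quarticSymbolPrime_spec (prime_star hl) hl2' hl').1
  have hst := quarticSymbolPrime_star (prime_star hl) hl2' ϖ
  rw [star_star] at hst
  rw [sq, quarticSymbolPrime_mul hl hl2, quarticSymbolPrime_mul hl hl2,
    quarticSymbolPrime_mul hl hl2, hst] at hsymb
  have htt := mul_star_eq_one_of_pow_four ht
  linear_combination (quarticSymbolPrime ϖ l * quarticSymbolPrime ϖ (star l)) * hsymb -
    (quarticSymbolPrime ϖ (star l) * star (quarticSymbolPrime ϖ (star l)) *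
      quarticSymbolPrime q ϖ) * hs - quarticSymbolPrime q ϖ * htt

lemma quarticSymbol_associated (a : GaussianInt) {m n : GaussianInt} (h : Associated m n) :
    quarticSymbol a m = quarticSymbol a n := by
  obtain ⟨u, rfl⟩ := h
  by_cases hm : m = 0
  · rw [hm, zero_mul]
  · rw [quarticSymbol_mul_right a hm u.isUnit.ne_zero, quarticSymbol_unit a u.isUnit, mul_one]

lemma prime_of_norm_eq_prime {l : GaussianInt} {q : ℕ} (hq : q.Prime)
    (hl : Zsqrtd.norm l = q) : Prime l := by
  rw [← irreducible_iff_prime, irreducible_iff]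
  constructor
  · rw [← Zsqrtd.norm_eq_one_iff, hl, Int.natAbs_natCast]
    exact hq.ne_one
  · rintro x y rfl
    have h := congrArg Int.natAbs hl
    rw [Zsqrtd.norm_mul, Int.natAbs_mul, Int.natAbs_natCast] at h
    rw [← Zsqrtd.norm_eq_one_iff, ← Zsqrtd.norm_eq_one_iff]
    rcases (Nat.dvd_prime hq).mp ⟨_, h.symm⟩ with h' | h'
    · exact Or.inl h'
    · right
      rw [h'] at h
      exact (Nat.mul_eq_left hq.ne_zero).mp h

lemma exists_prime_norm_eq {q : ℕ} (hq : q.Prime) (hq4 : q % 4 = 1) :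
    ∃ l : GaussianInt, Prime l ∧ Zsqrtd.norm l = q := by
  have := Fact.mk hq
  obtain ⟨a, b, hab⟩ := Nat.Prime.sq_add_sq (p := q) (by omega)
  have hn : Zsqrtd.norm (⟨a, b⟩ : GaussianInt) = q := by
    rw [Zsqrtd.norm_def, ← hab]
    push_cast
    ring
  exact ⟨_, prime_of_norm_eq_prime hq hn, hn⟩

lemma exists_nat_prime_dvd {ϖ : GaussianInt} (hϖ : Prime ϖ) :
    ∃ p : ℕ, p.Prime ∧ ϖ ∣ (p : GaussianInt) := by
  have h : ϖ ∣ ((Zsqrtd.norm ϖ).natAbs : GaussianInt) :=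
    ⟨star ϖ, by rw [mul_star_eq_norm, natCast_natAbs_norm]⟩
  have h0 : (Zsqrtd.norm ϖ).natAbs ≠ 0 := by
    rw [Ne, Int.natAbs_eq_zero, norm_eq_zero]
    exact hϖ.ne_zero
  rw [← Nat.prod_primeFactorsList h0, Nat.cast_list_prod, hϖ.dvd_prod_iff] at h
  obtain ⟨_, ha, hd⟩ := h
  obtain ⟨p, hp, rfl⟩ := List.mem_map.mp ha
  exact ⟨p, Nat.prime_of_mem_primeFactorsList hp, hd⟩

lemma prime_cases {ϖ : GaussianInt} (hϖ : Prime ϖ) :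
    (∃ p : ℕ, p.Prime ∧ Associated (p : GaussianInt) ϖ) ∨
      ∃ p : ℕ, p.Prime ∧ Zsqrtd.norm ϖ = p := by
  obtain ⟨p, hp, c, hc⟩ := exists_nat_prime_dvd hϖ
  have hn := congrArg (fun x => (Zsqrtd.norm x).natAbs) hc
  simp only [Zsqrtd.norm_mul, Zsqrtd.norm_natCast, Int.natAbs_mul, Int.natAbs_natCast] at hn
  rw [← sq] at hn
  obtain ⟨i, hi, h⟩ := (Nat.dvd_prime_pow hp).mp ⟨_, hn⟩
  interval_cases i
  · exact absurd (Zsqrtd.norm_eq_one_iff.mp h) hϖ.not_isUnit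
  · right
    refine ⟨p, hp, ?_⟩
    rw [← abs_natCast_norm, h, pow_one]
  · left
    rw [h] at hn
    have hu := (Nat.mul_eq_left (pow_ne_zero 2 hp.ne_zero)).mp hn.symm
    exact ⟨p, hp, hc ▸ (associated_mul_unit_right ϖ c (Zsqrtd.norm_eq_one_iff.mp hu)).symm⟩

lemma isCoprime_two_of_dvd_sub_one {n : GaussianInt} (h : 2 ∣ n - 1) : IsCoprime n 2 := by
  obtain ⟨c, hc⟩ := h
  exact ⟨1, -c, by linear_combination hc⟩

lemma natCast_isCoprime_two {q : ℕ} (hq : q % 2 = 1) : IsCoprime (q : GaussianInt) 2 := by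
  apply isCoprime_two_of_dvd_sub_one
  refine ⟨(q / 2 : ℕ), ?_⟩
  have : q = 2 * (q / 2) + 1 := by omega
  conv_lhs => rw [this]
  push_cast
  ring

lemma quarticSymbol_intCast_natCast_prime {q : ℕ} (hq : q.Prime) (hq2 : q % 2 = 1) {a : ℤ}
    (ha : IsCoprime a q) : quarticSymbol a (q : GaussianInt) = 1 := by
  have := Fact.mk hq
  have hcop2 := natCast_isCoprime_two hq2
  have hflt := Int.ModEq.pow_card_sub_one_eq_one hq ha
  have hcop : IsCoprime (a : GaussianInt) (q : GaussianInt) := by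
    simpa using ha.map (Int.castRingHom GaussianInt)
  rcases (by omega : q % 4 = 3 ∨ q % 4 = 1) with hq4 | hq4
  · have hqp := prime_of_nat_prime_of_mod_four_eq_three q hq4
    rw [quarticSymbol_prime _ hqp, quarticSymbolPrime_eq_iff hqp
      (not_dvd_two_of_isCoprime hqp hcop2 dvd_rfl) (by simp), Zsqrtd.norm_natCast]
    have h2 : (((q : ℤ) * q).natAbs - 1) / 4 = (q - 1) * ((q + 1) / 4) := by
      rw [← Int.natCast_mul, Int.natAbs_natCast]
      have hqm : q = 4 * (q / 4) + 3 := by omega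
      generalize q / 4 = m at hqm
      have h3 : q * q = 4 * ((4 * m + 2) * (m + 1)) + 1 := by rw [hqm]; ring
      have h4 : (q + 1) / 4 = m + 1 := by omega
      rw [h4, show q - 1 = 4 * m + 2 by omega]
      omega
    have h3 := (hflt.pow ((q + 1) / 4)).symm.dvd
    rw [one_pow, ← pow_mul, ← h2] at h3
    have := map_dvd (Int.castRingHom GaussianInt) h3
    simpa using this
  · obtain ⟨l, hl, hlq⟩ := exists_prime_norm_eq hq hq4
    have hql : (q : GaussianInt) = l * star l := by rw [mul_star_eq_norm, hlq, Int.cast_natCast]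
    have hl2 := not_dvd_two_of_isCoprime hl hcop2 ⟨_, hql⟩
    have hla : ¬ l ∣ a := fun h => hl.not_isUnit (hcop.isUnit_of_dvd' h ⟨_, hql⟩)
    have hstar := quarticSymbolPrime_star hl hl2 a
    rw [star_intCast] at hstar
    rw [hql, quarticSymbol_mul_right _ hl.ne_zero (prime_star hl).ne_zero,
      quarticSymbol_prime _ hl, quarticSymbol_prime _ (prime_star hl), hstar]
    exact mul_star_eq_one_of_pow_four (quarticSymbolPrime_spec hl hl2 hla).1

lemma quarticSymbol_intCast_natCast {N : ℕ} (hN : N % 2 = 1) {a : ℤ}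
    (ha : IsCoprime a N) : quarticSymbol a (N : GaussianInt) = 1 := by
  induction N using Nat.recOnMul with
  | zero => simp at hN
  | one => rw [Nat.cast_one, quarticSymbol_unit _ isUnit_one]
  | prime p hp => exact quarticSymbol_intCast_natCast_prime hp hN ha
  | mul m n hm hn =>
    obtain ⟨hm2, hn2⟩ := Nat.odd_mul.mp (Nat.odd_iff.mpr hN)
    rw [Nat.cast_mul] at ha ⊢
    rw [quarticSymbol_mul_right _ (by exact_mod_cast hm2.pos.ne') (by exact_mod_cast hn2.pos.ne'),
      hm (Nat.odd_iff.mp hm2) ha.of_mul_right_left, hn (Nat.odd_iff.mp hn2) ha.of_mul_right_right,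
      one_mul]

lemma associated_natAbs (d : ℤ) : Associated (d.natAbs : GaussianInt) (d : GaussianInt) := by
  simpa using (Int.associated_natAbs d).symm.map (Int.castRingHom GaussianInt)

lemma exists_eq_intCast {ϖ : GaussianInt} {p : ℕ} (hp2 : p % 2 = 1) (hodd : 2 ∣ ϖ - 1)
    (h : Associated (p : GaussianInt) ϖ) : ∃ a : ℤ, ϖ = a ∧ a.natAbs = p := by
  obtain ⟨u, hu⟩ := h
  obtain ⟨c, hc⟩ := hodd
  have hun := (Zsqrtd.norm_eq_one_iff.mpr u.isUnit)
  have him : ϖ.im = p * (u : GaussianInt).im := by rw [← hu]; simp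
  have hre : ϖ.re = p * (u : GaussianInt).re := by rw [← hu]; simp
  have him' : ϖ.im = 2 * c.im := by simpa using congrArg Zsqrtd.im hc
  have hun' : (u : GaussianInt).re ^ 2 + (u : GaussianInt).im ^ 2 = 1 := by
    have := abs_natCast_norm (u : GaussianInt)
    rw [hun, Zsqrtd.norm_def] at this
    push_cast at this
    linear_combination -this
  have heven : (u : GaussianInt).im % 2 = 0 := by
    have h1 : ((p : ℤ) * (u : GaussianInt).im) % 2 = 0 := by rw [← him, him']; omega
    rw [Int.mul_emod, show (p : ℤ) % 2 = 1 by omega, one_mul, Int.emod_emod] at h1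
    exact h1
  have hz : (u : GaussianInt).im = 0 := by
    have : (u : GaussianInt).im ^ 2 ≤ 1 := by nlinarith [sq_nonneg (u : GaussianInt).re]
    have h3 : -1 ≤ (u : GaussianInt).im ∧ (u : GaussianInt).im ≤ 1 := by
      constructor <;> nlinarith
    omega
  refine ⟨ϖ.re, ?_, ?_⟩
  · ext
    · simp
    · simp [him, hz]
  · rw [hz] at hun'
    have : (u : GaussianInt).re.natAbs = 1 := by
      have hun'' : (u : GaussianInt).re = 1 ∨ (u : GaussianInt).re = -1 := by simpa using hun'
      rcases hun'' with h | h <;> rw [h] <;> rfl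
    rw [hre, Int.natAbs_mul, this]
    simp

lemma quarticSymbol_comm_of_prime_of_natAbs_prime {ϖ : GaussianInt} (hϖ : Prime ϖ)
    (hodd : 2 ∣ ϖ - 1) {d : ℤ} (hd : d % 4 = 1) (hq : d.natAbs.Prime)
    (hcop : IsCoprime (d : GaussianInt) ϖ) : quarticSymbol ϖ d = quarticSymbol d ϖ := by
  have hϖ2 := not_dvd_two_of_isCoprime hϖ (isCoprime_two_of_dvd_sub_one hodd) dvd_rfl
  have hdq := associated_natAbs d
  rw [← quarticSymbol_associated ϖ hdq]
  have hcop' : IsCoprime (d.natAbs : GaussianInt) ϖ := by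
    obtain ⟨u, hu⟩ := hdq
    rw [← hu] at hcop
    exact hcop.of_mul_left_left
  generalize hqd : d.natAbs = q at *
  have hq2 : q % 2 = 1 := by omega
  have hq2' := natCast_isCoprime_two hq2
  have := Fact.mk hq
  rcases prime_cases hϖ with ⟨p, hp, hpϖ⟩ | ⟨p, hp, hpϖ⟩
  · have hp2 : p % 2 = 1 := by
      by_contra h
      have hp2 := (hp.eq_two_or_odd).resolve_right h
      rw [hp2] at hpϖ
      exact hϖ2 (by simpa using hpϖ.symm.dvd)
    have hpq : p ≠ q := by
      rintro rfl
      exact hϖ.not_isUnit (hcop'.isUnit_of_dvd' hpϖ.symm.dvd dvd_rfl)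
    obtain ⟨a, rfl, ha⟩ := exists_eq_intCast hp2 hodd hpϖ
    rw [← quarticSymbol_associated d hpϖ, quarticSymbol_intCast_natCast_prime hq hq2,
      quarticSymbol_intCast_natCast_prime hp hp2]
    · rw [Int.isCoprime_iff_gcd_eq_one, Int.gcd, hqd, Int.natAbs_natCast]
      exact (Nat.coprime_primes hq hp).mpr hpq.symm
    · rw [Int.isCoprime_iff_gcd_eq_one, Int.gcd, ha, Int.natAbs_natCast]
      exact (Nat.coprime_primes hp hq).mpr hpq
  · rw [quarticSymbol_prime _ hϖ]
    rcases (by omega : q % 4 = 3 ∨ q % 4 = 1) with hq4 | hq4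
    · have hdq' : d = -(q : ℤ) := by omega
      have hqp := prime_of_nat_prime_of_mod_four_eq_three q hq4
      rw [quarticSymbol_prime _ hqp, hdq']
      push_cast
      refine quarticSymbolPrime_of_mod_four_eq_three hϖ hodd hp hpϖ hq hq4 hqp
        (fun h => hqp.not_isUnit (hcop'.isUnit_of_dvd' dvd_rfl h)) hϖ2
        (not_dvd_two_of_isCoprime hqp hq2' dvd_rfl)
    · have hdq' : d = (q : ℤ) := by omega
      obtain ⟨l, hl, hlq⟩ := exists_prime_norm_eq hq hq4
      have hql : (q : GaussianInt) = l * star l := by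
        rw [mul_star_eq_norm, hlq, Int.cast_natCast]
      rw [hdq', Int.cast_natCast, quarticSymbolPrime_of_mod_four_eq_one hϖ hodd hp hpϖ hq hq4 hl hlq
        (fun h => hl.not_isUnit (hcop'.isUnit_of_dvd' ⟨_, hql⟩ h)) ?_ hϖ2
        (not_dvd_two_of_isCoprime hl hq2' ⟨_, hql⟩), hql,
        quarticSymbol_mul_right _ hl.ne_zero (prime_star hl).ne_zero,
        quarticSymbol_prime _ hl, quarticSymbol_prime _ (prime_star hl)]
      intro h
      rw [← star_dvd_star, star_star] at h
      exact (prime_star hl).not_isUnit (hcop'.isUnit_of_dvd' ⟨l, by rw [hql, mul_comm]⟩ h)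

lemma quarticSymbol_one_left {n : GaussianInt} (hn : IsCoprime n 2) : quarticSymbol 1 n = 1 := by
  have h := quarticSymbol_mul_left hn 1 1
  have h4 := quarticSymbol_pow_four hn isCoprime_one_left
  have h0 : quarticSymbol 1 n ≠ 0 := by
    intro h0
    simp [h0] at h4
  rw [mul_one] at h
  exact mul_left_cancel₀ h0 (by rw [← h, mul_one])

lemma quarticSymbol_comm_of_prime {ϖ : GaussianInt} (hϖ : Prime ϖ) (hodd : 2 ∣ ϖ - 1) {d : ℤ}
    (hd : d % 4 = 1) (hcop : IsCoprime (d : GaussianInt) ϖ) :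
    quarticSymbol ϖ d = quarticSymbol d ϖ := by
  induction h : d.natAbs using Nat.strong_induction_on generalizing d with
  | _ N ih =>
    by_cases h1 : d.natAbs = 1
    · have : d = 1 := by omega
      rw [this, Int.cast_one, quarticSymbol_unit _ isUnit_one,
        quarticSymbol_one_left (isCoprime_two_of_dvd_sub_one hodd)]
    · obtain ⟨q, hq, hqd⟩ := Nat.exists_prime_and_dvd h1
      obtain ⟨c, hc⟩ := Int.natCast_dvd.mpr hqd
      have hq2 : q % 2 = 1 := by
        by_contra h2
        rw [(hq.eq_two_or_odd).resolve_right h2] at hc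
        omega
      obtain ⟨e, e', he, hee, heq, he'⟩ : ∃ e e' : ℤ, e % 4 = 1 ∧ d = e * e' ∧ e.natAbs = q ∧
          e'.natAbs = c.natAbs := by
        rcases (by omega : q % 4 = 1 ∨ q % 4 = 3) with h4 | h4
        · exact ⟨q, c, by omega, hc, by simp, rfl⟩
        · exact ⟨-q, -c, by omega, by rw [hc]; ring, by simp, by simp⟩
      have he'4 : e' % 4 = 1 := by
        rw [hee, Int.mul_emod, he, one_mul, Int.emod_emod] at hd
        exact hd
      have hlt : e'.natAbs < N := by
        rw [← h, hee, Int.natAbs_mul, heq]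
        exact lt_mul_left (by omega) hq.one_lt
      rw [hee, Int.cast_mul] at hcop
      have r1 := quarticSymbol_comm_of_prime_of_natAbs_prime hϖ hodd he (heq ▸ hq)
        hcop.of_mul_left_left
      have r2 := ih _ hlt he'4 hcop.of_mul_left_right rfl
      rw [hee, Int.cast_mul, quarticSymbol_mul_right, quarticSymbol_mul_left
        (isCoprime_two_of_dvd_sub_one hodd), r1, r2]
      · exact_mod_cast (by omega : e ≠ 0)
      · exact_mod_cast (by omega : e' ≠ 0)

lemma intCast_isCoprime_two {d : ℤ} (hd : d % 4 = 1) : IsCoprime (d : GaussianInt) 2 := by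
  apply isCoprime_two_of_dvd_sub_one
  have : (2 : ℤ) ∣ d - 1 := by omega
  simpa using map_dvd (Int.castRingHom GaussianInt) this

lemma exists_associated_two_dvd_sub_one {ϖ : GaussianInt} (h : IsCoprime ϖ 2) :
    ∃ ϖ', Associated ϖ ϖ' ∧ 2 ∣ ϖ' - 1 := by
  have hu : ¬ IsUnit (⟨1, 1⟩ : GaussianInt) := by
    rw [← Zsqrtd.norm_eq_one_iff]; decide
  have h11 : ¬ (⟨1, 1⟩ : GaussianInt) ∣ ϖ :=
    fun h' => hu (h.isUnit_of_dvd' h' ⟨⟨1, -1⟩, by decide⟩)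
  have hpar : (ϖ.re + ϖ.im) % 2 = 1 := by
    by_contra h
    apply h11
    refine ⟨⟨(ϖ.re + ϖ.im) / 2, (ϖ.im - ϖ.re) / 2⟩, ?_⟩
    ext <;> simp <;> omega
  rcases (by omega : ϖ.im % 2 = 0 ∨ ϖ.re % 2 = 0) with h0 | h0
  · refine ⟨ϖ, Associated.refl _, ⟨⟨(ϖ.re - 1) / 2, ϖ.im / 2⟩, ?_⟩⟩
    ext <;> simp <;> omega
  · have hi : IsUnit (⟨0, 1⟩ : GaussianInt) := by
      rw [← Zsqrtd.norm_eq_one_iff]; decide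
    refine ⟨ϖ * ⟨0, 1⟩, associated_mul_unit_right _ _ hi,
      ⟨⟨(-ϖ.im - 1) / 2, ϖ.re / 2⟩, ?_⟩⟩
    ext <;> simp <;> omega

/-- Quartic reciprocity between a rational integer `d ≡ 1 (mod 4)` and a Gaussian integer
`n ≡ 1 (mod 2)`. -/
theorem quarticSymbol_comm {n : GaussianInt} (hn : 2 ∣ n - 1) {d : ℤ} (hd : d % 4 = 1)
    (hcop : IsCoprime (d : GaussianInt) n) : quarticSymbol n d = quarticSymbol d n := by
  suffices ∀ m, Associated n m → 2 ∣ m - 1 → IsCoprime (d : GaussianInt) m →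
      quarticSymbol m d = quarticSymbol d m from this n (Associated.refl _) hn hcop
  clear hn hcop
  induction n using UniqueFactorizationMonoid.induction_on_prime with
  | h₁ =>
    intro m hm h2
    exact absurd ((associated_zero_iff_eq_zero m).mp hm.symm)
      (ne_zero_of_isCoprime_two (isCoprime_two_of_dvd_sub_one h2))
  | h₂ n hn =>
    intro m hm h2 _
    obtain ⟨a, rfl, ha⟩ := exists_eq_intCast (p := 1) rfl h2
      (by simpa using (associated_one_iff_isUnit.mpr (hm.isUnit hn)).symm)
    rw [quarticSymbol_unit _ (hm.isUnit hn), ← quarticSymbol_associated _ (associated_natAbs d)]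
    exact quarticSymbol_intCast_natCast (by omega)
      (Int.isCoprime_iff_gcd_eq_one.mpr (by rw [Int.gcd, ha, Nat.gcd_one_left]))
  | h₃ n ϖ hn hϖ ih =>
    intro m hm h2 hcop
    have hϖm : ϖ ∣ m := (dvd_mul_right _ _).trans hm.dvd
    have hm2 := isCoprime_two_of_dvd_sub_one h2
    obtain ⟨ϖ', hass, h2'⟩ := exists_associated_two_dvd_sub_one
      (hm2.of_isCoprime_of_dvd_left hϖm)
    obtain ⟨c, rfl⟩ := hass.symm.dvd.trans hϖm
    have hϖ' := hass.prime hϖ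
    have hnc : Associated n c := hm.of_mul_left hass hϖ.ne_zero
    have h2c : 2 ∣ c - 1 := by
      have : c - 1 = (ϖ' * c - 1) - (ϖ' - 1) * c := by ring
      rw [this]
      exact dvd_sub h2 (h2'.mul_right c)
    have hc0 : c ≠ 0 := hnc.ne_zero_iff.mp hn
    rw [quarticSymbol_mul_left (intCast_isCoprime_two hd), quarticSymbol_mul_right _ hϖ'.ne_zero hc0,
      quarticSymbol_comm_of_prime hϖ' h2' hd hcop.of_mul_right_left,
      ih c hnc h2c hcop.of_mul_right_right]

lemma echar_eq_exp_im (z : ℂ) : echar z = Complex.exp (2 * Real.pi * I * z.im) := by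
  rw [echar, ← sub_div, Complex.sub_conj]
  congr 1
  push_cast
  field_simp

lemma echar_add (z w : ℂ) : echar (z + w) = echar z * echar w := by
  rw [echar_eq_exp_im, echar_eq_exp_im, echar_eq_exp_im, ← Complex.exp_add, add_im]
  push_cast
  ring_nf

lemma echar_toComplex (x : GaussianInt) : echar (toComplex x) = 1 := by
  rw [echar_eq_exp_im, Complex.exp_eq_one_iff]
  refine ⟨x.im, ?_⟩
  rw [← intCast_im, ofReal_intCast]
  ring

lemma echar_div_congr {m x y : GaussianInt} (hm : m ≠ 0) (h : m ∣ x - y) :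
    echar (toComplex x / toComplex m) = echar (toComplex y / toComplex m) := by
  obtain ⟨c, hc⟩ := h
  have hm' : toComplex m ≠ 0 := by simpa using hm
  have : toComplex x / toComplex m = toComplex y / toComplex m + toComplex c := by
    rw [div_add' _ _ _ hm', div_left_inj' hm', eq_add_of_sub_eq' hc, map_add, map_mul,
      mul_comm m.toComplex]
  rw [this, echar_add, echar_toComplex, mul_one]

/-- The summand of the quartic Gauss sum modulo `m`. -/
def gaussTerm (m x : GaussianInt) : ℂ :=
  toComplex (quarticSymbol x m) * echar (toComplex x / toComplex m)

lemma gaussTerm_congr {m x y : GaussianInt} (hm : IsCoprime m 2) (h : m ∣ x - y) :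
    gaussTerm m x = gaussTerm m y := by
  rw [gaussTerm, gaussTerm, quarticSymbol_congr hm h,
    echar_div_congr (ne_zero_of_isCoprime_two hm) h]

lemma quarticGaussSum_eq_finsum (m : GaussianInt) :
    quarticGaussSum m = ∑ᶠ x : GaussianInt ⧸ Ideal.span {m}, gaussTerm m x.out := by
  simp only [quarticGaussSum, gaussSumK, gaussTerm, map_one, one_mul]

lemma gaussTerm_mul {d n : GaussianInt} (hd : IsCoprime d 2) (hn : IsCoprime n 2)
    (a b : GaussianInt) :
    gaussTerm (d * n) (d * a + n * b) =
      toComplex (quarticSymbol n d * quarticSymbol d n) * (gaussTerm n a * gaussTerm d b) := by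
  have hd0 := ne_zero_of_isCoprime_two hd
  have hn0 := ne_zero_of_isCoprime_two hn
  have hd' : toComplex d ≠ 0 := by simpa using hd0
  have hn' : toComplex n ≠ 0 := by simpa using hn0
  have h1 : quarticSymbol (d * a + n * b) d = quarticSymbol n d * quarticSymbol b d := by
    rw [← quarticSymbol_mul_left hd]
    exact quarticSymbol_congr hd ⟨a, by ring⟩
  have h2 : quarticSymbol (d * a + n * b) n = quarticSymbol d n * quarticSymbol a n := by
    rw [← quarticSymbol_mul_left hn]
    exact quarticSymbol_congr hn ⟨b, by ring⟩
  have h3 : toComplex (d * a + n * b) / toComplex (d * n) =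
      toComplex a / toComplex n + toComplex b / toComplex d := by
    simp only [map_add, map_mul]
    field_simp
  rw [gaussTerm, h3, echar_add, quarticSymbol_mul_right _ hd0 hn0, h1, h2, gaussTerm, gaussTerm]
  simp only [map_mul]
  ring

lemma dvd_mk_out_sub (m x : GaussianInt) :
    m ∣ (Ideal.Quotient.mk (Ideal.span {m}) x).out - x := by
  rw [← Ideal.mem_span_singleton, ← Ideal.Quotient.eq]
  exact Quotient.out_eq _

lemma mk_out (m : GaussianInt) (x : GaussianInt ⧸ Ideal.span {m}) :
    Ideal.Quotient.mk (Ideal.span {m}) x.out = x :=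
  Quotient.out_eq x

lemma eq_of_dvd_out_sub_out {m : GaussianInt} {x y : GaussianInt ⧸ Ideal.span {m}}
    (h : m ∣ x.out - y.out) : x = y := by
  rw [← mk_out m x, ← mk_out m y, Ideal.Quotient.eq, Ideal.mem_span_singleton]
  exact h

lemma bijective_mk_mul_add_mul {d n : GaussianInt} (h : IsCoprime d n) :
    Function.Bijective
      fun p : (GaussianInt ⧸ Ideal.span {n}) × (GaussianInt ⧸ Ideal.span {d}) =>
        Ideal.Quotient.mk (Ideal.span {d * n}) (d * p.1.out + n * p.2.out) := by
  constructor
  · rintro ⟨a, b⟩ ⟨a', b'⟩ hab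
    rw [Ideal.Quotient.eq, Ideal.mem_span_singleton] at hab
    have hn : n ∣ d * (a.out - a'.out) := by
      have := (dvd_sub ((dvd_mul_left n d).trans hab) (dvd_mul_right n (b.out - b'.out)))
      convert this using 1
      ring
    have hd : d ∣ n * (b.out - b'.out) := by
      have := (dvd_sub ((dvd_mul_right d n).trans hab) (dvd_mul_right d (a.out - a'.out)))
      convert this using 1
      ring
    exact Prod.ext (eq_of_dvd_out_sub_out (h.symm.dvd_of_dvd_mul_left hn))
      (eq_of_dvd_out_sub_out (h.dvd_of_dvd_mul_left hd))
  · intro x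
    obtain ⟨u, v, huv⟩ := h
    refine ⟨⟨Ideal.Quotient.mk _ (u * x.out), Ideal.Quotient.mk _ (v * x.out)⟩, ?_⟩
    obtain ⟨c, hc⟩ := dvd_mk_out_sub n (u * x.out)
    obtain ⟨e, he⟩ := dvd_mk_out_sub d (v * x.out)
    conv_rhs => rw [← mk_out _ x]
    rw [Ideal.Quotient.eq, Ideal.mem_span_singleton]
    exact ⟨c + e, by linear_combination d * hc + n * he + x.out * huv⟩

/-- Twisted multiplicativity of the quartic Gauss sum. -/
theorem quarticGaussSum_mul {d n : GaussianInt} (hd : IsCoprime d 2) (hn : IsCoprime n 2)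
    (h : IsCoprime d n) :
    quarticGaussSum (d * n) =
      toComplex (quarticSymbol n d * quarticSymbol d n) *
        quarticGaussSum d * quarticGaussSum n := by
  have hdn : IsCoprime (d * n) 2 := hd.mul_left hn
  have := finite_quotient_span (ne_zero_of_isCoprime_two hd)
  have := finite_quotient_span (ne_zero_of_isCoprime_two hn)
  have := finite_quotient_span (ne_zero_of_isCoprime_two hdn)
  have := Fintype.ofFinite (GaussianInt ⧸ Ideal.span {d})
  have := Fintype.ofFinite (GaussianInt ⧸ Ideal.span {n})
  have := Fintype.ofFinite (GaussianInt ⧸ Ideal.span {d * n})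
  simp only [quarticGaussSum_eq_finsum, finsum_eq_sum_of_fintype]
  rw [← (bijective_mk_mul_add_mul h).sum_comp, mul_assoc,
    mul_comm (∑ x : GaussianInt ⧸ Ideal.span {d}, gaussTerm d x.out),
    Finset.sum_mul_sum, Fintype.sum_prod_type, Finset.mul_sum]
  refine Finset.sum_congr rfl fun a _ => ?_
  rw [Finset.mul_sum]
  refine Finset.sum_congr rfl fun b _ => ?_
  rw [gaussTerm_congr hdn (dvd_mk_out_sub _ _), gaussTerm_mul hd hn]

lemma star_eq_self_of_sq_eq_one {x : GaussianInt} (hx : x ^ 2 = 1) : star x = x := by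
  rcases mul_self_eq_one_iff.mp ((sq x).symm.trans hx) with rfl | rfl <;> simp

end GaussianInt

/-- for rational primary `d ≡ 1 (mod 4)` and primary `n` coprime to `d`,
both odd, `g(dn) = conj((d²/n)₄) g(d) g(n)`. -/
theorem quarticGaussSum_rational_mul (d : ℤ) (n : GaussianInt) (hd : d ≡ 1 [ZMOD 4])
    (hn : IsPrimary n) (hcop : IsCoprime (d : GaussianInt) n)
    (hd2 : IsCoprime (d : GaussianInt) 2) (hn2 : IsCoprime n 2) :
    quarticGaussSum ((d : GaussianInt) * n) =
      conj (GaussianInt.toComplex (quarticSymbol ((d : GaussianInt) ^ 2) n)) *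
        quarticGaussSum (d : GaussianInt) * quarticGaussSum n := by
  have h2 : 2 ∣ n - 1 := Dvd.dvd.trans ⟨⟨-1, 1⟩, by decide⟩ hn
  have hsq : quarticSymbol ((d : GaussianInt) ^ 2) n = quarticSymbol d n * quarticSymbol d n := by
    rw [sq, GaussianInt.quarticSymbol_mul_left hn2]
  have hreal : (quarticSymbol d n * quarticSymbol d n) ^ 2 = 1 := by
    rw [← GaussianInt.quarticSymbol_pow_four hn2 hcop]
    ring
  rw [GaussianInt.quarticGaussSum_mul hd2 hn2 hcop, GaussianInt.quarticSymbol_comm h2 hd hcop, hsq,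
    ← GaussianInt.toComplex_star, GaussianInt.star_eq_self_of_sq_eq_one hreal]
end
end

section
/- Let n = a + bi ∈ ℤ[i] be primary, square-free, free of rational prime divisors, with gcd(a,b)=1. Then (conj(n)/n)₄ = (-2/n)₄ · (-1)^((a²-1)/8). -/
noncomputable section
open Complex
open scoped ComplexConjugate Classical

/-- The ring homomorphism `ℤ[i] → 𝔽_p` with kernel generated by an element of prime norm `p`. -/
lemma exists_residueHom {p : ℕ} [Fact p.Prime] {ϖ : GaussianInt} (hϖ : ϖ.norm = p) :
    ∃ ρ : GaussianInt →+* ZMod p, ∀ z, ρ z = 0 ↔ ϖ ∣ z := by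
  obtain ⟨c, d⟩ := ϖ
  have hcd : c * c + d * d = p := by rw [← hϖ]; simp [Zsqrtd.norm_def]
  have hpp : Prime (p : ℤ) := Nat.prime_iff_prime_int.mp Fact.out
  have hcdp : (c : ZMod p) * c + d * d = 0 := by
    have := congrArg (Int.cast : ℤ → ZMod p) hcd
    push_cast at this
    simpa using this
  have hd : (d : ZMod p) ≠ 0 := by
    intro h
    have hc : (c : ZMod p) = 0 := by simpa [h] using hcdp
    rw [ZMod.intCast_zmod_eq_zero_iff_dvd] at h hc
    obtain ⟨k, rfl⟩ := h
    obtain ⟨l, rfl⟩ := hc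
    have h1 : (p : ℤ) * (p * (l * l + k * k)) = p * 1 := by linear_combination hcd
    exact hpp.not_isUnit (IsUnit.of_mul_eq_one _ (mul_left_cancel₀ hpp.ne_zero h1))
  let ρ : GaussianInt →+* ZMod p := Zsqrtd.lift ⟨-(c : ZMod p) / d, by
    field_simp
    push_cast
    linear_combination hcdp⟩
  have hρ (z : GaussianInt) : d * ρ z = z.re * d - z.im * c := by
    change (d : ZMod p) * (z.re + z.im * (-(c : ZMod p) / d)) = _
    field_simp
    ring
  refine ⟨ρ, fun z ↦ ⟨fun h ↦ ?_, ?_⟩⟩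
  · have h1 : (z.re : ZMod p) * d - z.im * c = 0 := by rw [← hρ, h, mul_zero]
    have h2 : (z.re : ZMod p) * c + z.im * d = 0 := by
      have : (d : ZMod p) * (z.re * c + z.im * d) = 0 := by
        linear_combination c * h1 + z.im * hcdp
      exact (mul_eq_zero.mp this).resolve_left hd
    have h3 : (p : ℤ) ∣ z.re * d - z.im * c := by
      rw [← ZMod.intCast_zmod_eq_zero_iff_dvd]; exact_mod_cast h1
    have h4 : (p : ℤ) ∣ z.re * c + z.im * d := by
      rw [← ZMod.intCast_zmod_eq_zero_iff_dvd]; exact_mod_cast h2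
    obtain ⟨k, hk⟩ := h3
    obtain ⟨l, hl⟩ := h4
    refine ⟨⟨l, -k⟩, ?_⟩
    have hp0 : (p : ℤ) ≠ 0 := hpp.ne_zero
    ext
    · apply mul_left_cancel₀ hp0
      simp only [Zsqrtd.re_mul]
      linear_combination z.re * (-hcd) + c * hl + d * hk
    · apply mul_left_cancel₀ hp0
      simp only [Zsqrtd.im_mul]
      linear_combination z.im * (-hcd) + d * hl - c * hk
  · rintro ⟨w, rfl⟩
    have : (d : ZMod p) * ρ ⟨c, d⟩ = 0 := by rw [hρ]; ring
    rw [map_mul, (mul_eq_zero.mp this).resolve_left hd, zero_mul]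

lemma GaussianInt.mem_fourthRoots_iff {ζ : GaussianInt} :
    ζ ∈ ({1, -1, ⟨0, 1⟩, ⟨0, -1⟩} : Set GaussianInt) ↔ ζ ^ 4 = 1 := by
  constructor
  · rintro (rfl | rfl | rfl | rfl) <;> decide
  · intro h
    have : (ζ - 1) * ((ζ + 1) * ((ζ - ⟨0, 1⟩) * (ζ + ⟨0, 1⟩))) = 0 := by
      have hI : (⟨0, 1⟩ : GaussianInt) ^ 2 = -1 := by decide
      linear_combination h - (ζ ^ 2 - 1) * hI
    simp only [mul_eq_zero, sub_eq_zero, add_eq_zero_iff_eq_neg] at this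
    exact this

/-- A ring homomorphism to a field of odd characteristic separates fourth roots of unity. -/
lemma GaussianInt.eq_of_map_eq {F : Type*} [Field F] (h2 : (2 : F) ≠ 0) (f : GaussianInt →+* F)
    {ζ ξ : GaussianInt} (hζ : ζ ^ 4 = 1) (hξ : ξ ^ 4 = 1) (h : f ζ = f ξ) : ζ = ξ := by
  have h4 : (4 : F) ≠ 0 := by
    have : (4 : F) = 2 * 2 := by norm_num
    rw [this]
    exact mul_ne_zero h2 h2
  have hn : (((ζ - ξ).norm : ℤ) : F) = 0 := by
    rw [← map_intCast f, Zsqrtd.norm_eq_mul_conj, map_mul, map_sub, h, sub_self, zero_mul]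
  rw [← mem_fourthRoots_iff] at hζ hξ
  simp only [Set.mem_insert_iff, Set.mem_singleton_iff] at hζ hξ
  rcases hζ with rfl | rfl | rfl | rfl <;> rcases hξ with rfl | rfl | rfl | rfl <;>
    first
    | rfl
    | (exfalso
       simp [Zsqrtd.norm_def] at hn
       first | exact h2 hn | exact h4 hn)

section Symbol

variable {p : ℕ} [Fact p.Prime] {ϖ : GaussianInt} {ρ : GaussianInt →+* ZMod p}

lemma ZMod.two_ne_zero_of_mod_four (hp : p % 4 = 1) : (2 : ZMod p) ≠ 0 := by
  intro h
  have : ((2 : ℕ) : ZMod p) = 0 := by exact_mod_cast h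
  rw [ZMod.natCast_eq_zero_iff] at this
  have := Nat.le_of_dvd (by norm_num) this
  have := (Fact.out : p.Prime).two_le
  lia

lemma quarticSymbolPrime_spec (hp : p % 4 = 1) (hϖ : ϖ.norm = p) (hρ : ∀ z, ρ z = 0 ↔ ϖ ∣ z)
    (z : GaussianInt) :
    (¬ϖ ∣ z → quarticSymbolPrime z ϖ ^ 4 = 1) ∧
      ρ (quarticSymbolPrime z ϖ) = ρ z ^ ((p - 1) / 4) := by
  have hp2 := (Fact.out : p.Prime).two_le
  by_cases hz : ϖ ∣ z
  · have : (p - 1) / 4 ≠ 0 := by lia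
    simp [quarticSymbolPrime, hz, (hρ z).mpr hz, this]
  have hN : (ϖ.norm.natAbs - 1) / 4 = (p - 1) / 4 := by rw [hϖ, Int.natAbs_natCast]
  have hw : (ρ z ^ ((p - 1) / 4)) ^ 4 = 1 := by
    rw [← pow_mul, show (p - 1) / 4 * 4 = p - 1 by lia]
    exact ZMod.pow_card_sub_one_eq_one (mt (hρ z).mp hz)
  have hex : ∃ ζ : GaussianInt, ζ ∈ ({1, -1, ⟨0, 1⟩, ⟨0, -1⟩} : Set GaussianInt) ∧
      ϖ ∣ z ^ ((ϖ.norm.natAbs - 1) / 4) - ζ := by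
    simp_rw [hN, ← hρ, map_sub, map_pow]
    set w := ρ z ^ ((p - 1) / 4)
    have hI : ρ ⟨0, 1⟩ ^ 2 = -1 := by
      rw [← map_pow, show (⟨0, 1⟩ : GaussianInt) ^ 2 = -1 by decide, map_neg, map_one]
    have hI' : ρ ⟨0, -1⟩ = -ρ ⟨0, 1⟩ := by rw [← map_neg]; rfl
    have : (w - 1) * ((w + 1) * ((w - ρ ⟨0, 1⟩) * (w + ρ ⟨0, 1⟩))) = 0 := by
      linear_combination hw - (w ^ 2 - 1) * hI
    rcases mul_eq_zero.mp this with h | h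
    · exact ⟨1, by simp, by simpa using h⟩
    rcases mul_eq_zero.mp h with h | h
    · exact ⟨-1, by simp, by simpa using h⟩
    rcases mul_eq_zero.mp h with h | h
    · exact ⟨⟨0, 1⟩, by simp, by simpa using h⟩
    · exact ⟨⟨0, -1⟩, by simp, by simpa [hI'] using h⟩
  have hsymb : quarticSymbolPrime z ϖ = hex.choose := by
    rw [quarticSymbolPrime, if_neg hz, dif_pos hex]
  rw [hsymb]
  obtain ⟨h1, h2⟩ := hex.choose_spec
  refine ⟨fun _ ↦ GaussianInt.mem_fourthRoots_iff.mp h1, ?_⟩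
  rw [← hρ, map_sub, sub_eq_zero, map_pow] at h2
  exact h2.symm.trans (by rw [hN])

/-- The quartic residue symbol modulo a prime of norm `p` comes from a character of `𝔽_p`. -/
lemma exists_quarticChar (hp : p % 4 = 1) (hϖ : ϖ.norm = p) (hρ : ∀ z, ρ z = 0 ↔ ϖ ∣ z) :
    ∃ χ : MulChar (ZMod p) GaussianInt, (∀ z, χ (ρ z) = quarticSymbolPrime z ϖ) ∧
      (∀ x ≠ 0, χ x ^ 4 = 1) ∧ ∀ x, ρ (χ x) = x ^ ((p - 1) / 4) := by
  have h2 := ZMod.two_ne_zero_of_mod_four hp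
  have hp2 := (Fact.out : p.Prime).two_le
  have spec := quarticSymbolPrime_spec hp hϖ hρ
  have hsurj (x : ZMod p) : ρ (x.val : GaussianInt) = x := by simp
  have hndvd {z} : ¬ϖ ∣ z ↔ ρ z ≠ 0 := (hρ z).not.symm
  have hzero {z} (hz : ϖ ∣ z) : quarticSymbolPrime z ϖ = 0 := by simp [quarticSymbolPrime, hz]
  have uniq {z ζ} (hz : ¬ϖ ∣ z) (h4 : ζ ^ 4 = 1) (hζ : ρ ζ = ρ z ^ ((p - 1) / 4)) :
      quarticSymbolPrime z ϖ = ζ :=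
    GaussianInt.eq_of_map_eq h2 ρ ((spec z).1 hz) h4 ((spec z).2.trans hζ.symm)
  have congr {z w} (h : ρ z = ρ w) : quarticSymbolPrime z ϖ = quarticSymbolPrime w ϖ := by
    by_cases hz : ϖ ∣ z
    · rw [hzero hz, hzero ((hρ w).mp (h ▸ (hρ z).mpr hz))]
    · exact uniq hz ((spec w).1 (by rwa [hndvd, ← h, ← hndvd])) (by rw [(spec w).2, h])
  let χ : MulChar (ZMod p) GaussianInt :=
    { toFun x := quarticSymbolPrime (x.val : GaussianInt) ϖ
      map_one' := uniq (by rw [hndvd, hsurj]; exact one_ne_zero) (one_pow 4) (by simp)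
      map_mul' x y := by
        by_cases hx : x = 0
        · rw [hx, zero_mul, hzero (z := ((0 : ZMod p).val : GaussianInt)) (by simp), zero_mul]
        by_cases hy : y = 0
        · rw [hy, mul_zero, hzero (z := ((0 : ZMod p).val : GaussianInt)) (by simp), mul_zero]
        apply uniq
        · rw [hndvd, hsurj]
          exact mul_ne_zero hx hy
        · rw [mul_pow, (spec _).1 (by rwa [hndvd, hsurj]), (spec _).1 (by rwa [hndvd, hsurj]),
            one_mul]
        · rw [map_mul, (spec _).2, (spec _).2, hsurj, hsurj, hsurj, mul_pow]
      map_nonunit' x hx := hzero (by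
        rw [isUnit_iff_ne_zero, not_not] at hx
        rw [← hρ, hsurj, hx]) }
  refine ⟨χ, fun z ↦ congr (hsurj _), fun x hx ↦ (spec _).1 (by rwa [hndvd, hsurj]), fun x ↦ ?_⟩
  exact (spec _).2.trans (by rw [hsurj])

end Symbol

section QuarticChar

variable {p : ℕ} [Fact p.Prime] {χ : MulChar (ZMod p) GaussianInt}

lemma map_jacobiSum_eq_zero {ρ : GaussianInt →+* ZMod p}
    (hχ : ∀ x, ρ (χ x) = x ^ ((p - 1) / 4)) : ρ (jacobiSum χ χ) = 0 := by
  have hp2 := (Fact.out : p.Prime).two_le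
  simp only [jacobiSum, map_sum, map_mul, hχ]
  set k := (p - 1) / 4 with hk
  have expand (x : ZMod p) : x ^ k * (1 - x) ^ k =
      ∑ m ∈ Finset.range (k + 1), (-1) ^ m * (k.choose m : ZMod p) * x ^ (k + m) := by
    rw [sub_eq_neg_add, add_pow, Finset.mul_sum]
    refine Finset.sum_congr rfl fun m _ ↦ ?_
    rw [neg_pow x m, one_pow, pow_add]
    ring
  simp_rw [expand]
  rw [Finset.sum_comm]
  refine Finset.sum_eq_zero fun m hm ↦ ?_
  rw [← Finset.mul_sum, FiniteField.sum_pow_lt_card_sub_one, mul_zero]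
  rw [Finset.mem_range] at hm
  rw [ZMod.card]
  lia

lemma exists_apply_sq_eq_neg_one {ρ : GaussianInt →+* ZMod p} (hp : p % 4 = 1)
    (h4 : ∀ x ≠ 0, χ x ^ 4 = 1) (hχ : ∀ x, ρ (χ x) = x ^ ((p - 1) / 4)) :
    ∃ x, χ x ^ 2 = -1 := by
  obtain ⟨x, hx⟩ := FiniteField.exists_nonsquare (F := ZMod p)
    (by rw [ZMod.ringChar_zmod_n]; rintro rfl; lia)
  have hx0 : x ≠ 0 := by rintro rfl; exact hx (IsSquare.zero)
  refine ⟨x, ?_⟩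
  have h : (χ x ^ 2 - 1) * (χ x ^ 2 + 1) = 0 := by linear_combination h4 x hx0
  rcases mul_eq_zero.mp h with h | h
  · exfalso
    apply hx
    rw [ZMod.euler_criterion p hx0, show p / 2 = (p - 1) / 4 * 2 by lia, pow_mul, ← hχ, ← map_pow,
      sub_eq_zero.mp h, map_one]
  · exact eq_neg_of_add_eq_zero_left h

lemma ringHomComp_mul_self_ne_one {K : Type*} [Field K] (h2 : (2 : K) ≠ 0) (φ : GaussianInt →+* K)
    (h : ∃ x, χ x ^ 2 = -1) : χ.ringHomComp φ * χ.ringHomComp φ ≠ 1 := by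
  obtain ⟨x, hx⟩ := h
  intro h1
  have h := congrArg (fun ψ ↦ ψ x) h1
  have hxu : IsUnit x := by
    by_contra hxu
    rw [χ.map_nonunit hxu] at hx
    exact absurd hx (by decide)
  simp only [MulChar.mul_apply, MulChar.ringHomComp_apply, MulChar.one_apply hxu] at h
  rw [← map_mul, ← sq, hx, map_neg, map_one] at h
  apply h2
  linear_combination -h

lemma norm_jacobiSum (h : ∃ x, χ x ^ 2 = -1) : (jacobiSum χ χ).norm = p := by
  set θ := χ.ringHomComp GaussianInt.toComplex with hθ
  have h1 : θ * θ ≠ 1 := ringHomComp_mul_self_ne_one two_ne_zero _ h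
  have h0 : θ ≠ 1 := fun h ↦ h1 (by rw [h, mul_one])
  have key := jacobiSum_mul_jacobiSum_inv (F' := ℂ)
    (by rw [ringChar.eq_zero, ZMod.ringChar_zmod_n]; exact (Fact.out : p.Prime).ne_zero.symm)
    h0 h0 h1
  have hconj : jacobiSum θ⁻¹ θ⁻¹ = conj (jacobiSum θ θ) := by
    simp only [jacobiSum, map_sum, map_mul, ← MulChar.star_apply', Complex.star_def]
  rw [hconj, Complex.mul_conj, hθ, jacobiSum_ringHomComp, ← GaussianInt.intCast_complex_norm,
    ZMod.card] at key
  exact_mod_cast key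

lemma two_dvd_jacobiSum_sub_one (hp : p % 4 = 1) (h4 : ∀ x ≠ 0, χ x ^ 4 = 1) :
    2 ∣ jacobiSum χ χ - 1 := by
  have hμ : IsPrimitiveRoot (⟨0, 1⟩ : GaussianInt) 4 := by
    rw [IsPrimitiveRoot.iff (by norm_num)]
    refine ⟨by decide, fun l hl hl4 ↦ ?_⟩
    interval_cases l <;> decide
  have hχ4 : χ ^ 4 = 1 := by
    refine MulChar.ext fun u ↦ ?_
    rw [MulChar.pow_apply_coe, MulChar.one_apply_coe, h4 _ u.ne_zero]
  obtain ⟨z, -, hz⟩ := exists_jacobiSum_eq_neg_one_add (by norm_num) hχ4 hχ4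
    (by rw [ZMod.card]; lia) hμ
  refine ⟨-1 - z * ⟨0, 1⟩, ?_⟩
  have : ((⟨0, 1⟩ : GaussianInt) - 1) ^ 2 = -2 * ⟨0, 1⟩ := by decide
  rw [hz, this]
  ring

/-- The fourth power of a quartic Gauss sum. -/
lemma gaussSum_pow_four_s12 {K : Type*} [Field K] (h2 : (2 : K) ≠ 0) (φ : GaussianInt →+* K)
    (h : ∃ x, χ x ^ 2 = -1) (h4 : ∀ x ≠ 0, χ x ^ 4 = 1) {ψ : AddChar (ZMod p) K}
    (hψ : ψ.IsPrimitive) :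
    gaussSum (χ.ringHomComp φ) ψ ^ 4 = φ (jacobiSum χ χ) ^ 2 * p := by
  set θ := χ.ringHomComp φ with hθ
  have h1 : θ * θ ≠ 1 := ringHomComp_mul_self_ne_one h2 _ h
  have hq : (θ * θ).IsQuadratic := by
    intro x
    by_cases hx : x = 0
    · exact Or.inl (by rw [hx, MulChar.map_zero])
    right
    have : ((θ * θ) x - 1) * ((θ * θ) x + 1) = 0 := by
      have := congrArg φ (h4 x hx)
      simp only [map_pow, map_one] at this
      simp only [MulChar.mul_apply, hθ, MulChar.ringHomComp_apply]
      linear_combination this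
    rcases mul_eq_zero.mp this with h | h
    · exact Or.inl (sub_eq_zero.mp h)
    · exact Or.inr (eq_neg_of_add_eq_zero_left h)
  have hsq := gaussSum_sq h1 hq hψ
  have hneg : (θ * θ) (-1) = 1 := by
    rw [MulChar.mul_apply, ← map_mul, neg_mul_neg, one_mul, map_one]
  rw [hneg, one_mul, ZMod.card] at hsq
  have hJ := jacobiSum_mul_nontrivial h1 ψ
  rw [hθ, jacobiSum_ringHomComp, ← hθ] at hJ
  linear_combination (φ (jacobiSum χ χ)) ^ 2 * hsq -
    (gaussSum θ ψ * gaussSum θ ψ + gaussSum (θ * θ) ψ * φ (jacobiSum χ χ)) * hJ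

end QuarticChar

/-- The Gauss sum attached to a Gaussian prime of prime norm `p`, in characteristic `q`. -/
lemma exists_gaussSum {p q : ℕ} [Fact p.Prime] [Fact q.Prime] (hp : p % 4 = 1) (hpq : p ≠ q)
    {K : Type*} [Field K] [IsAlgClosed K] [CharP K q] (h2 : (2 : K) ≠ 0) (φ : GaussianInt →+* K)
    {ϖ : GaussianInt} (hϖ : ϖ.norm = p) :
    ∃ (G : K) (J : GaussianInt), Associated J ϖ ∧ 2 ∣ J - 1 ∧ G ^ 4 = φ J ^ 2 * p ∧
      (q % 4 = 1 → φ (quarticSymbolPrime q ϖ) * G ^ q = G) ∧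
      (q % 4 = 3 → G ^ (q + 1) = φ (quarticSymbolPrime (-q) ϖ) * p) := by
  obtain ⟨ρ, hρ⟩ := exists_residueHom hϖ
  obtain ⟨χ, hχ, h4, hρχ⟩ := exists_quarticChar hp hϖ hρ
  have hneg := exists_apply_sq_eq_neg_one hp h4 hρχ
  have hpK : NeZero (p : K) := ⟨by
    rw [Ne, CharP.cast_eq_zero_iff K q, Nat.prime_dvd_prime_iff_eq Fact.out Fact.out]
    exact hpq.symm⟩
  have hqp : (q : ZMod p) ≠ 0 := by
    rw [Ne, ZMod.natCast_eq_zero_iff, Nat.prime_dvd_prime_iff_eq Fact.out Fact.out]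
    exact hpq
  obtain ⟨ζ, hζ⟩ := HasEnoughRootsOfUnity.exists_primitiveRoot K p
  set ψ := AddChar.zmodChar p ((IsPrimitiveRoot.iff_def ζ p).mp hζ).left
  have hψ : ψ.IsPrimitive := AddChar.zmodChar_primitive_of_primitive_root p hζ
  set θ := χ.ringHomComp φ with hθ
  have hθq : θ q = φ (quarticSymbolPrime q ϖ) := by
    rw [← hχ, map_natCast ρ, hθ, MulChar.ringHomComp_apply]
  have hθ4 : θ ^ 4 = 1 := by
    ext u
    rw [MulChar.pow_apply_coe, MulChar.one_apply_coe, hθ, MulChar.ringHomComp_apply, ← map_pow,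
      h4 _ u.ne_zero, map_one]
  have hfrob : gaussSum θ ψ ^ q = gaussSum (θ ^ q) (ψ.mulShift q) := by
    rw [gaussSum_frob, AddChar.pow_mulShift]
  have hshift (η : MulChar (ZMod p) K) :
      η q * gaussSum η (ψ.mulShift q) = gaussSum η ψ := by
    have := gaussSum_mulShift η ψ (Units.mk0 (q : ZMod p) hqp)
    rwa [Units.val_mk0] at this
  refine ⟨gaussSum θ ψ, jacobiSum χ χ, ?_, two_dvd_jacobiSum_sub_one hp h4,
    gaussSum_pow_four_s12 h2 φ hneg h4 hψ, fun hq ↦ ?_, fun hq ↦ ?_⟩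
  · obtain ⟨t, ht⟩ := (hρ _).mp (map_jacobiSum_eq_zero hρχ)
    have hN := norm_jacobiSum hneg
    rw [ht, Zsqrtd.norm_mul, hϖ] at hN
    have ht1 : t.norm = 1 := by
      have hp0 : (p : ℤ) ≠ 0 := by exact_mod_cast (Fact.out : p.Prime).ne_zero
      exact mul_left_cancel₀ hp0 (hN.trans (mul_one _).symm)
    rw [ht]
    exact associated_mul_unit_left _ _ ((Zsqrtd.norm_eq_one_iff' (by norm_num) _).mp ht1)
  · rw [hfrob, ← hθq, show θ ^ q = θ by
      rw [← Nat.div_add_mod q 4, hq, pow_add, pow_mul, hθ4, one_pow, one_mul, pow_one]]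
    exact hshift θ
  · have hinv : θ ^ q = θ⁻¹ := by
      rw [← Nat.div_add_mod q 4, hq, pow_add, pow_mul, hθ4, one_pow, one_mul]
      exact eq_inv_of_mul_eq_one_left (by rw [← pow_succ, hθ4])
    have h1 := ringHomComp_mul_self_ne_one h2 φ hneg
    rw [← hθ] at h1
    have h0 : θ ≠ 1 := fun h ↦ h1 (by rw [h, mul_one])
    have hprod := gaussSum_mul_gaussSum_eq_card h0 hψ
    have hsh := hshift θ⁻¹
    have hng := mul_gaussSum_inv_eq_gaussSum θ⁻¹ ψ
    rw [ZMod.card] at hprod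
    have hinvq : θ q * θ⁻¹ q = 1 := by
      rw [← MulChar.mul_apply, mul_inv_cancel, MulChar.one_apply (isUnit_iff_ne_zero.mpr hqp)]
    have hneg1 : θ⁻¹ (-1) = θ (-1) := by
      rw [MulChar.inv_apply', inv_neg, inv_one]
    have hθnq : φ (quarticSymbolPrime (-q) ϖ) = θ (-1) * θ q := by
      rw [← map_mul, ← hχ, map_neg, map_natCast, hθ, MulChar.ringHomComp_apply, neg_one_mul]
    rw [pow_succ, hfrob, hinv, hθnq]
    rw [hneg1] at hng
    linear_combination θ (-1) * θ q * hprod - θ q * gaussSum θ ψ * hng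
      + θ q * gaussSum θ ψ * hsh - gaussSum θ ψ * gaussSum θ⁻¹ (ψ.mulShift q) * hinvq

/-- The norm is a rational prime `p ≡ 1 mod 4`. -/
def HasSplitNorm (ϖ : GaussianInt) : Prop := ∃ p : ℕ, p.Prime ∧ p % 4 = 1 ∧ ϖ.norm = p

lemma exists_gaussSum_prod {q : ℕ} [Fact q.Prime] {K : Type*} [Field K] [IsAlgClosed K] [CharP K q]
    (h2 : (2 : K) ≠ 0) (φ : GaussianInt →+* K) (s : Multiset GaussianInt)
    (hs : ∀ ϖ ∈ s, HasSplitNorm ϖ) (hq : ∀ ϖ ∈ s, ϖ.norm ≠ q) :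
    ∃ (G : K) (J : GaussianInt), Associated J s.prod ∧ 2 ∣ J - 1 ∧
      G ^ 4 = φ J ^ 2 * (s.prod.norm : K) ∧
      (q % 4 = 1 → φ (s.map (quarticSymbolPrime q)).prod * G ^ q = G) ∧
      (q % 4 = 3 → G ^ (q + 1) = φ (s.map (quarticSymbolPrime (-q))).prod * (s.prod.norm : K)) := by
  induction s using Multiset.induction_on with
  | empty => exact ⟨1, 1, by simp, by simp, by simp, by simp, by simp⟩
  | cons ϖ s ih =>
    obtain ⟨G, J, h1, h2', h3, h4, h5⟩ := ih (fun x hx ↦ hs x (Multiset.mem_cons_of_mem hx))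
      (fun x hx ↦ hq x (Multiset.mem_cons_of_mem hx))
    obtain ⟨p, hp, hp4, hϖ⟩ := hs ϖ (Multiset.mem_cons_self _ _)
    have : Fact p.Prime := ⟨hp⟩
    have hpq : p ≠ q := fun h ↦ hq ϖ (Multiset.mem_cons_self _ _) (by rw [hϖ, h])
    obtain ⟨G', J', k1, k2, k3, k4, k5⟩ := exists_gaussSum hp4 hpq h2 φ hϖ
    refine ⟨G' * G, J' * J, ?_, ?_, ?_, fun hq4 ↦ ?_, fun hq4 ↦ ?_⟩
    · rw [Multiset.prod_cons]
      exact k1.mul_mul h1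
    · have : J' * J - 1 = (J' - 1) * J + (J - 1) := by ring
      rw [this]
      exact dvd_add (k2.mul_right _) h2'
    · rw [mul_pow, k3, h3, Multiset.prod_cons, Zsqrtd.norm_mul, hϖ, map_mul]
      push_cast
      ring
    · rw [Multiset.map_cons, Multiset.prod_cons, map_mul]
      linear_combination G * k4 hq4 + φ (quarticSymbolPrime q ϖ) * G' ^ q * h4 hq4
    · rw [Multiset.map_cons, Multiset.prod_cons, Multiset.prod_cons, map_mul, Zsqrtd.norm_mul, hϖ,
        mul_pow, k5 hq4, h5 hq4]
      push_cast
      ring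

lemma quarticSymbol_of_ne_zero {n : GaussianInt} (hn : n ≠ 0) (z : GaussianInt) :
    quarticSymbol z n =
      ((UniqueFactorizationMonoid.factors n).map (quarticSymbolPrime z)).prod := by
  rw [quarticSymbol, if_neg hn]

section QuarticSymbol

variable {n : GaussianInt}

lemma quarticSymbol_one (hn : n ≠ 0)
    (hs : ∀ ϖ ∈ UniqueFactorizationMonoid.factors n, HasSplitNorm ϖ) :
    quarticSymbol 1 n = 1 := by
  rw [quarticSymbol_of_ne_zero hn]
  refine Multiset.prod_eq_one fun x hx ↦ ?_
  obtain ⟨ϖ, hϖ, rfl⟩ := Multiset.mem_map.mp hx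
  obtain ⟨p, hp, hp4, hN⟩ := hs ϖ hϖ
  have : Fact p.Prime := ⟨hp⟩
  obtain ⟨ρ, hρ⟩ := exists_residueHom hN
  obtain ⟨χ, hχ, -⟩ := exists_quarticChar hp4 hN hρ
  rw [← hχ, map_one, map_one]

lemma quarticSymbol_mul (hn : n ≠ 0)
    (hs : ∀ ϖ ∈ UniqueFactorizationMonoid.factors n, HasSplitNorm ϖ) (z w : GaussianInt) :
    quarticSymbol (z * w) n = quarticSymbol z n * quarticSymbol w n := by
  simp only [quarticSymbol_of_ne_zero hn]
  rw [← Multiset.prod_map_mul]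
  refine congrArg _ (Multiset.map_congr rfl fun ϖ hϖ ↦ ?_)
  obtain ⟨p, hp, hp4, hN⟩ := hs ϖ hϖ
  have : Fact p.Prime := ⟨hp⟩
  obtain ⟨ρ, hρ⟩ := exists_residueHom hN
  obtain ⟨χ, hχ, -⟩ := exists_quarticChar hp4 hN hρ
  rw [← hχ, ← hχ, ← hχ, map_mul, map_mul]

lemma quarticSymbol_congr (hn : n ≠ 0)
    (hs : ∀ ϖ ∈ UniqueFactorizationMonoid.factors n, HasSplitNorm ϖ)
    {z w : GaussianInt} (h : n ∣ z - w) :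
    quarticSymbol z n = quarticSymbol w n := by
  simp only [quarticSymbol_of_ne_zero hn]
  refine congrArg _ (Multiset.map_congr rfl fun ϖ hϖ ↦ ?_)
  obtain ⟨p, hp, hp4, hN⟩ := hs ϖ hϖ
  have : Fact p.Prime := ⟨hp⟩
  obtain ⟨ρ, hρ⟩ := exists_residueHom hN
  obtain ⟨χ, hχ, -⟩ := exists_quarticChar hp4 hN hρ
  have := (hρ _).mpr ((UniqueFactorizationMonoid.dvd_of_mem_factors hϖ).trans h)
  rw [map_sub, sub_eq_zero] at this
  rw [← hχ, ← hχ, this]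

lemma quarticSymbol_pow_four (hn : n ≠ 0)
    (hs : ∀ ϖ ∈ UniqueFactorizationMonoid.factors n, HasSplitNorm ϖ)
    {z : GaussianInt}
    (hz : ∀ ϖ ∈ UniqueFactorizationMonoid.factors n, ¬ϖ ∣ z) : quarticSymbol z n ^ 4 = 1 := by
  rw [quarticSymbol_of_ne_zero hn, ← Multiset.prod_map_pow]
  refine Multiset.prod_eq_one fun x hx ↦ ?_
  obtain ⟨ϖ, hϖ, rfl⟩ := Multiset.mem_map.mp hx
  obtain ⟨p, hp, hp4, hN⟩ := hs ϖ hϖ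
  have : Fact p.Prime := ⟨hp⟩
  obtain ⟨ρ, hρ⟩ := exists_residueHom hN
  exact (quarticSymbolPrime_spec hp4 hN hρ z).1 (hz ϖ hϖ)

/-- The supplementary law for `-1`. -/
lemma quarticSymbol_neg_one (hn : n ≠ 0)
    (hs : ∀ ϖ ∈ UniqueFactorizationMonoid.factors n, HasSplitNorm ϖ) :
    quarticSymbol (-1) n = (ZMod.χ₈ n.norm : ℤ) := by
  rw [quarticSymbol_of_ne_zero hn, ← Zsqrtd.norm_eq_of_associated (by norm_num)
    (UniqueFactorizationMonoid.factors_prod hn)]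
  generalize UniqueFactorizationMonoid.factors n = s at hs
  induction s using Multiset.induction_on with
  | empty => simp
  | cons ϖ s ih =>
    obtain ⟨p, hp, hp4, hN⟩ := hs ϖ (Multiset.mem_cons_self _ _)
    have : Fact p.Prime := ⟨hp⟩
    obtain ⟨ρ, hρ⟩ := exists_residueHom hN
    obtain ⟨χ, hχ, h4, hρχ⟩ := exists_quarticChar hp4 hN hρ
    have h8 : ZMod.χ₈ p = (-1) ^ ((p - 1) / 4) := by
      rw [ZMod.χ₈_nat_eq_if_mod_eight, if_neg (by lia)]
      split_ifs with h
      · rw [Even.neg_one_pow (Nat.even_iff.mpr (by lia))]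
      · rw [Odd.neg_one_pow (Nat.odd_iff.mpr (by lia))]
    have hϖ : quarticSymbolPrime (-1) ϖ = (ZMod.χ₈ ϖ.norm : ℤ) := by
      rw [hN, Int.cast_natCast, h8, ← hχ]
      refine GaussianInt.eq_of_map_eq (ZMod.two_ne_zero_of_mod_four hp4) ρ (h4 _ ?_) ?_ ?_
      · simp
      · push_cast
        rw [← pow_mul, mul_comm, pow_mul, Even.neg_one_pow (by decide), one_pow]
      · simp [hρχ]
    rw [Multiset.map_cons, Multiset.prod_cons, Multiset.prod_cons, Zsqrtd.norm_mul, hϖ,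
      ih fun x hx ↦ hs x (Multiset.mem_cons_of_mem hx)]
    push_cast
    rw [map_mul]
    push_cast
    rfl

end QuarticSymbol

lemma hasSplitNorm_of_dvd {ϖ n : GaussianInt} (hϖ : Prime ϖ) (hn : ϖ ∣ n) (hodd : Odd n.norm)
    (hnr : ¬∃ p : ℕ, p.Prime ∧ (p : GaussianInt) ∣ n) : HasSplitNorm ϖ := by
  obtain ⟨p, hp, hdvd⟩ : ∃ p : ℕ, p.Prime ∧ ϖ ∣ p := by
    have h0 : ϖ.norm.natAbs ≠ 0 := by
      rw [Int.natAbs_ne_zero]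
      exact mt GaussianInt.norm_eq_zero.mp hϖ.ne_zero
    have h : ϖ ∣ ((ϖ.norm.natAbs : ℕ) : GaussianInt) := by
      rw [GaussianInt.natCast_natAbs_norm, Zsqrtd.norm_eq_mul_conj]
      exact dvd_mul_right _ _
    rw [← Nat.prod_primeFactorsList h0, Nat.cast_list_prod] at h
    obtain ⟨x, hx, hxd⟩ := hϖ.dvd_prod_iff.mp h
    obtain ⟨p, hp, rfl⟩ := List.mem_map.mp hx
    exact ⟨p, Nat.prime_of_mem_primeFactorsList hp, hxd⟩
  obtain ⟨t, ht⟩ := hdvd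
  have hN : ϖ.norm.natAbs * t.norm.natAbs = p ^ 2 := by
    rw [← Int.natAbs_mul, ← Zsqrtd.norm_mul, ← ht, Zsqrtd.norm_natCast, sq, Int.natAbs_mul,
      Int.natAbs_natCast]
  obtain ⟨k, hk, hk'⟩ := (Nat.dvd_prime_pow hp).mp (Dvd.intro _ hN)
  have hk1 : k = 1 := by
    interval_cases k
    · exact absurd (Zsqrtd.norm_eq_one_iff.mp hk') hϖ.not_isUnit
    · rfl
    · exfalso
      rw [hk'] at hN
      have ht1 : t.norm.natAbs = 1 :=
        Nat.eq_of_mul_eq_mul_left (pow_pos hp.pos 2) (hN.trans (mul_one _).symm)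
      refine hnr ⟨p, hp, ?_⟩
      rw [ht]
      exact ((Zsqrtd.norm_eq_one_iff.mp ht1).mul_right_dvd).mpr hn
  subst hk1
  have hNp : ϖ.norm = p := by rw [← GaussianInt.abs_natCast_norm, hk', pow_one]
  refine ⟨p, hp, ?_, hNp⟩
  have hpodd : Odd (p : ℤ) := by
    obtain ⟨w, rfl⟩ := hn
    rw [Zsqrtd.norm_mul, hNp] at hodd
    exact Int.Odd.of_mul_left hodd
  rw [Zsqrtd.norm_def] at hNp
  have h1 := Int.even_or_odd' ϖ.re
  have h2 := Int.even_or_odd' ϖ.im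
  obtain ⟨c, hc | hc⟩ := h1 <;> obtain ⟨d, hd | hd⟩ := h2 <;> rw [hc, hd] at hNp <;>
    ring_nf at hNp <;> obtain ⟨m, hm⟩ := hpodd <;> lia

lemma GaussianInt.ne_zero_of_odd_re {a : ℤ} (ha : Odd a) (b : ℤ) : (⟨a, b⟩ : GaussianInt) ≠ 0 := by
  intro h
  have := congrArg Zsqrtd.re h
  simp only [Zsqrtd.re_zero] at this
  rw [this] at ha
  exact absurd ha (by decide)

lemma map_eq_mul_of_re_eq_zero {K : Type*} [Field K] (φ : GaussianInt →+* K) (a b : ℤ)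
    (ha : (a : K) = 0) : φ ⟨a, b⟩ = b * φ ⟨0, 1⟩ := by
  have : (⟨a, b⟩ : GaussianInt) = (a : GaussianInt) + b * ⟨0, 1⟩ := by
    ext <;> simp
  rw [this, map_add, map_mul, map_intCast, map_intCast, ha, zero_add]

section PrimaryModulus

variable {a b : ℤ}

lemma sq_eq_of_associated_of_two_dvd_sub_one (ha : Odd a) (hb : Even b) {J : GaussianInt}
    (h : Associated J ⟨a, b⟩) (hJ : 2 ∣ J - 1) : J ^ 2 = ⟨a, b⟩ ^ 2 := by
  obtain ⟨u, hu⟩ := h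
  have hu4 : (u : GaussianInt) ^ 4 = 1 := by
    have hnu := (Zsqrtd.norm_eq_one_iff' (by norm_num) (u : GaussianInt)).mpr u.isUnit
    generalize (u : GaussianInt) = v at hnu ⊢
    obtain ⟨c, d⟩ := v
    simp only [Zsqrtd.norm_def] at hnu
    have hc : c ≤ 1 ∧ -1 ≤ c :=
      ⟨by nlinarith [mul_self_nonneg d], by nlinarith [mul_self_nonneg d]⟩
    have hd : d ≤ 1 ∧ -1 ≤ d :=
      ⟨by nlinarith [mul_self_nonneg c], by nlinarith [mul_self_nonneg c]⟩
    obtain ⟨hc1, hc2⟩ := hc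
    obtain ⟨hd1, hd2⟩ := hd
    interval_cases c <;> interval_cases d <;> first | (exfalso; revert hnu; decide) | decide
  obtain ⟨k, rfl⟩ := ha
  obtain ⟨l, rfl⟩ := hb
  obtain ⟨w, hw⟩ := hJ
  rw [← hu]
  rw [← GaussianInt.mem_fourthRoots_iff] at hu4
  rw [sub_eq_iff_eq_add.mp hw] at hu ⊢
  simp only [Set.mem_insert_iff, Set.mem_singleton_iff] at hu4
  rcases hu4 with h | h | h | h <;> rw [h] at hu ⊢
  · ring
  · ring
  · exfalso
    have := congrArg Zsqrtd.re hu
    simp [Zsqrtd.re_mul] at this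
    lia
  · exfalso
    have := congrArg Zsqrtd.re hu
    simp [Zsqrtd.re_mul] at this
    lia

/-- Quartic reciprocity between `a + bi` and a rational prime `q` dividing `a`. -/
lemma quarticSymbol_prime (ha : Odd a) (hb : Even b) (hab : Int.gcd a b = 1)
    (hs : ∀ ϖ ∈ UniqueFactorizationMonoid.factors (⟨a, b⟩ : GaussianInt), HasSplitNorm ϖ)
    {q : ℕ} [Fact q.Prime] (hq2 : Odd q) (hqa : (q : ℤ) ∣ a) :
    quarticSymbol (ZMod.χ₄ q * q : ℤ) ⟨a, b⟩ = (ZMod.χ₈ q : ℤ) := by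
  have hqp : q.Prime := Fact.out
  have hn0 := GaussianInt.ne_zero_of_odd_re ha b
  let K := AlgebraicClosure (ZMod q)
  have h2 : (2 : K) ≠ 0 := by
    intro h
    have : ((2 : ℕ) : K) = 0 := by exact_mod_cast h
    rw [CharP.cast_eq_zero_iff K q, Nat.prime_dvd_prime_iff_eq hqp Nat.prime_two] at this
    subst this
    exact absurd hq2 (by decide)
  obtain ⟨I, hI⟩ := IsAlgClosed.exists_pow_nat_eq (-1 : K) (n := 2) (by norm_num)
  let φ : GaussianInt →+* K := Zsqrtd.lift ⟨I, by push_cast; rw [← sq, hI]⟩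
  have haK : (a : K) = 0 := (CharP.intCast_eq_zero_iff K q a).mpr hqa
  have hqb : ¬(q : ℤ) ∣ b := by
    intro h
    have := Int.dvd_coe_gcd hqa h
    rw [hab] at this
    exact hqp.one_lt.ne' (by exact_mod_cast Int.eq_one_of_dvd_one (by positivity) this)
  have hbK : (b : K) ≠ 0 := mt (CharP.intCast_eq_zero_iff K q b).mp hqb
  have hbq : (b : K) ^ q = b := by rw [← frobenius_def, map_intCast]
  have hfac := UniqueFactorizationMonoid.factors_prod hn0
  have hnorm : (UniqueFactorizationMonoid.factors (⟨a, b⟩ : GaussianInt)).prod.norm =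
      a * a + b * b := by
    rw [Zsqrtd.norm_eq_of_associated (by norm_num) hfac, Zsqrtd.norm_def]
    ring
  have hne : ∀ ϖ ∈ UniqueFactorizationMonoid.factors (⟨a, b⟩ : GaussianInt), ϖ.norm ≠ q := by
    intro ϖ hϖ h
    have hdvd : (q : ℤ) ∣ a * a + b * b := by
      obtain ⟨w, hw⟩ := Multiset.dvd_prod hϖ
      rw [← hnorm, hw, Zsqrtd.norm_mul, h]
      exact dvd_mul_right _ _
    have := (dvd_add_right (hqa.mul_right a)).mp hdvd
    exact hqb (((Nat.prime_iff_prime_int.mp hqp).dvd_or_dvd this).elim id id)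
  obtain ⟨G, J, hJ, hJ2, hG, hq1, hq3⟩ := exists_gaussSum_prod (q := q) h2 φ _ hs hne
  simp only [← quarticSymbol_of_ne_zero hn0] at hq1 hq3
  rw [hnorm] at hG hq3
  have hφn : φ ⟨a, b⟩ ^ 2 = -(b : K) ^ 2 := by
    rw [map_eq_mul_of_re_eq_zero φ a b haK, mul_pow, ← map_pow,
      show (⟨0, 1⟩ : GaussianInt) ^ 2 = -1 by decide, map_neg, map_one]
    ring
  have hG4 : G ^ 4 = -(b : K) ^ 4 := by
    rw [hG, ← map_pow, sq_eq_of_associated_of_two_dvd_sub_one ha hb (hJ.trans hfac) hJ2, map_pow,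
      hφn]
    push_cast
    rw [haK]
    ring
  have hG0 : G ≠ 0 := by
    rintro rfl
    rw [zero_pow (by norm_num), eq_comm, neg_eq_zero] at hG4
    exact hbK (pow_eq_zero_iff (by norm_num) |>.mp hG4)
  have hndvd : ∀ ϖ ∈ UniqueFactorizationMonoid.factors (⟨a, b⟩ : GaussianInt),
      ¬ϖ ∣ (q : GaussianInt) := by
    rintro ϖ hϖ ⟨t, ht⟩
    obtain ⟨p, hp, -, hN⟩ := hs ϖ hϖ
    have h := congrArg Zsqrtd.norm ht
    rw [Zsqrtd.norm_mul, hN, Zsqrtd.norm_natCast] at h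
    have hpq : p ∣ q * q := by
      rw [← Int.natCast_dvd_natCast]
      push_cast
      exact Dvd.intro _ h.symm
    have := (Nat.prime_dvd_prime_iff_eq hp hqp).mp ((hp.dvd_mul.mp hpq).elim id id)
    exact hne ϖ hϖ (by rw [hN, this])
  have h8 (k : ℕ) : (((-1 : ℤ) ^ k : ℤ) : GaussianInt) ^ 4 = 1 := by
    push_cast
    rw [← pow_mul, mul_comm, pow_mul, Even.neg_one_pow (by decide), one_pow]
  have hmod : q % 4 = 1 ∨ q % 4 = 3 := by
    have := Nat.odd_iff.mp hq2
    lia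
  rcases hmod with hq4 | hq4
  · obtain ⟨k, hk⟩ : ∃ k, q = 4 * k + 1 := ⟨q / 4, by lia⟩
    have hχ8 : ZMod.χ₈ q = (-1) ^ k := by
      rw [ZMod.χ₈_nat_eq_if_mod_eight, if_neg (by lia)]
      split_ifs with h
      · rw [Even.neg_one_pow (Nat.even_iff.mpr (by lia))]
      · rw [Odd.neg_one_pow (Nat.odd_iff.mpr (by lia))]
    rw [hχ8, ZMod.χ₄_nat_one_mod_four hq4, one_mul, Int.cast_natCast]
    refine GaussianInt.eq_of_map_eq h2 φ (quarticSymbol_pow_four hn0 hs hndvd) (h8 k) ?_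
    have hb1 : (b : K) ^ (4 * k) = 1 :=
      mul_right_cancel₀ hbK (by rw [← pow_succ, ← hk, hbq, one_mul])
    have hGk : G ^ (4 * k) = (-1) ^ k := by
      rw [pow_mul, hG4, neg_pow, ← pow_mul, hb1, mul_one]
    have h := hq1 hq4
    have hGq : G ^ q = (-1) ^ k * G := by rw [← hGk, ← pow_succ, ← hk]
    rw [hGq] at h
    have hsq : ((-1 : K) ^ k) * (-1) ^ k = 1 := by
      rw [← mul_pow]
      norm_num
    have h' : φ (quarticSymbol q ⟨a, b⟩) * (-1) ^ k = 1 :=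
      mul_right_cancel₀ hG0 (by linear_combination h)
    push_cast
    rw [map_pow, map_neg, map_one]
    linear_combination (-1) ^ k * h' - φ (quarticSymbol q ⟨a, b⟩) * hsq
  · obtain ⟨k, hk⟩ : ∃ k, q + 1 = 4 * k := ⟨(q + 1) / 4, by lia⟩
    have hχ8 : ZMod.χ₈ q = (-1) ^ k := by
      rw [ZMod.χ₈_nat_eq_if_mod_eight, if_neg (by lia)]
      split_ifs with h
      · rw [Even.neg_one_pow (Nat.even_iff.mpr (by lia))]
      · rw [Odd.neg_one_pow (Nat.odd_iff.mpr (by lia))]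
    rw [hχ8, ZMod.χ₄_nat_three_mod_four hq4, neg_one_mul, Int.cast_neg, Int.cast_natCast]
    refine GaussianInt.eq_of_map_eq h2 φ (quarticSymbol_pow_four hn0 hs fun ϖ hϖ h ↦
      hndvd ϖ hϖ ((dvd_neg).mp h)) (h8 k) ?_
    have h := hq3 hq4
    rw [hk, pow_mul, hG4, neg_pow, ← pow_mul, ← hk, pow_succ, hbq] at h
    have hnK : ((a * a + b * b : ℤ) : K) = b * b := by
      rw [Int.cast_add, Int.cast_mul, Int.cast_mul, haK, zero_mul, zero_add]
    rw [hnK] at h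
    push_cast
    rw [map_pow, map_neg, map_one]
    refine mul_right_cancel₀ (mul_ne_zero hbK hbK) ?_
    linear_combination -h

lemma quarticSymbol_natCast (ha : Odd a) (hb : Even b) (hab : Int.gcd a b = 1)
    (hs : ∀ ϖ ∈ UniqueFactorizationMonoid.factors (⟨a, b⟩ : GaussianInt), HasSplitNorm ϖ)
    {m : ℕ} (hm : (m : ℤ) ∣ a) :
    quarticSymbol (ZMod.χ₄ m * m : ℤ) ⟨a, b⟩ = (ZMod.χ₈ m : ℤ) := by
  have hn0 := GaussianInt.ne_zero_of_odd_re ha b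
  induction m using Nat.recOnMul with
  | zero =>
    rw [Nat.cast_zero, zero_dvd_iff] at hm
    rw [hm] at ha
    exact absurd ha (by decide)
  | one => simpa using quarticSymbol_one hn0 hs
  | prime q hq =>
    have : Fact q.Prime := ⟨hq⟩
    refine quarticSymbol_prime ha hb hab hs ?_ hm
    obtain ⟨w, hw⟩ := hm
    exact_mod_cast (Int.odd_mul.mp (hw ▸ ha)).1
  | mul m k ihm ihk =>
    push_cast at hm
    have h1 := ihm ((dvd_mul_right _ _).trans hm)
    have h2 := ihk ((dvd_mul_left _ _).trans hm)
    have : (ZMod.χ₄ (m * k : ℕ) * (m * k : ℕ) : ℤ) = (ZMod.χ₄ m * m) * (ZMod.χ₄ k * k) := by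
      push_cast
      rw [map_mul]
      ring
    rw [this, Int.cast_mul, quarticSymbol_mul hn0 hs, h1, h2]
    push_cast
    rw [map_mul]
    push_cast
    rfl

/-- The quartic symbol of `-a` modulo a primary `a + bi`. -/
lemma quarticSymbol_neg_re (ha : Odd a) (hb : Even b) (hab : Int.gcd a b = 1)
    (hs : ∀ ϖ ∈ UniqueFactorizationMonoid.factors (⟨a, b⟩ : GaussianInt), HasSplitNorm ϖ)
    (hab4 : (a + b) % 4 = 1) :
    quarticSymbol (-a : GaussianInt) ⟨a, b⟩ = (ZMod.χ₈ a : ℤ) := by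
  have hn0 := GaussianInt.ne_zero_of_odd_re ha b
  have habs := quarticSymbol_natCast ha hb hab hs (m := a.natAbs) (Int.natAbs_dvd.mpr dvd_rfl)
  have hodd := Int.odd_iff.mp ha
  have hχ8 : ZMod.χ₈ (a.natAbs : ℕ) = ZMod.χ₈ a := by
    have heven : ∀ x : ZMod 8, ZMod.χ₈ (-x) = ZMod.χ₈ x := by decide
    rcases a.natAbs_eq with h | h <;> conv_rhs => rw [h]
    · rw [Int.cast_natCast]
    · rw [Int.cast_neg, Int.cast_natCast, heven]
  rw [hχ8] at habs
  have hmod : a % 4 = 1 ∨ a % 4 = 3 := by lia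
  rcases hmod with h4 | h4
  · have hχ4 : (ZMod.χ₄ (a.natAbs : ℕ) * (a.natAbs : ℕ) : ℤ) = a := by
      rw [ZMod.χ₄_nat_eq_if_mod_four, if_neg (by lia)]
      split_ifs <;> lia
    have hneg : quarticSymbol (-1) ⟨a, b⟩ = 1 := by
      rw [quarticSymbol_neg_one hn0 hs, ZMod.χ₈_int_eq_if_mod_eight]
      obtain ⟨c, hc⟩ : ∃ c, a = 4 * c + 1 := ⟨a / 4, by lia⟩
      obtain ⟨d, hd⟩ : ∃ d, b = 4 * d := ⟨b / 4, by lia⟩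
      have hN : (⟨a, b⟩ : GaussianInt).norm = 8 * (2 * c * c + c + 2 * d * d) + 1 := by
        rw [Zsqrtd.norm_def, hc, hd]
        ring
      rw [hN, if_neg (by lia), if_pos (by lia), Int.cast_one]
    rw [hχ4] at habs
    rw [← neg_one_mul, quarticSymbol_mul hn0 hs, hneg, one_mul, habs]
  · have hχ4 : (ZMod.χ₄ (a.natAbs : ℕ) * (a.natAbs : ℕ) : ℤ) = -a := by
      rw [ZMod.χ₄_nat_eq_if_mod_four, if_neg (by lia)]
      split_ifs <;> lia
    rw [hχ4, Int.cast_neg] at habs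
    exact habs

end PrimaryModulus

lemma χ₈_eq_neg_one_zpow {a : ℤ} (ha : Odd a) :
    ((ZMod.χ₈ a : ℤ) : ℂ) = (-1 : ℂ) ^ ((a ^ 2 - 1) / 8) := by
  rw [ZMod.χ₈_int_eq_if_mod_eight, if_neg (by rw [Int.odd_iff] at ha; lia)]
  obtain ⟨k, r, rfl, hr⟩ : ∃ k r, a = 8 * k + r ∧ (r = 1 ∨ r = 3 ∨ r = 5 ∨ r = 7) :=
    ⟨a / 8, a % 8, by lia, by rw [Int.odd_iff] at ha; lia⟩
  have hexp : (8 * k + r) ^ 2 - 1 = 8 * (2 * (4 * k ^ 2 + k * r)) + (r ^ 2 - 1) := by ring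
  rw [hexp, Int.add_ediv_of_dvd_left (dvd_mul_right _ _), Int.mul_ediv_cancel_left _ (by norm_num),
    zpow_add₀ (by norm_num), Even.neg_one_zpow (even_two_mul _), one_mul]
  rcases hr with rfl | rfl | rfl | rfl
  · rw [if_pos (by lia)]
    norm_num
  · rw [if_neg (by lia)]
    norm_num
  · rw [if_neg (by lia)]
    norm_num
  · rw [if_pos (by lia)]
    norm_num

lemma IsPrimary.odd_even_mod_four {a b : ℤ} (h : IsPrimary ⟨a, b⟩) :
    Odd a ∧ Even b ∧ (a + b) % 4 = 1 := by
  obtain ⟨⟨c, d⟩, hw⟩ := h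
  have h3 : (⟨1, 1⟩ : GaussianInt) ^ 3 = ⟨-2, 2⟩ := by decide
  rw [h3] at hw
  have hre := congrArg Zsqrtd.re hw
  have him := congrArg Zsqrtd.im hw
  simp only [Zsqrtd.re_sub, Zsqrtd.im_sub, Zsqrtd.re_one, Zsqrtd.im_one, Zsqrtd.re_mul,
    Zsqrtd.im_mul] at hre him
  rw [Int.odd_iff, Int.even_iff]
  lia

/-- for primary, square-free `n = a+bi` free of rational prime divisors with
`gcd(a,b) = 1`, `(conj(n)/n)₄ = (-2/n)₄ · (-1)^((a²-1)/8)`. -/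
theorem conj_symbol_formula (a b : ℤ) (hp : IsPrimary (⟨a, b⟩ : GaussianInt))
    (hsf : Squarefree (⟨a, b⟩ : GaussianInt))
    (hnr : ¬∃ p : ℕ, p.Prime ∧ (p : GaussianInt) ∣ (⟨a, b⟩ : GaussianInt))
    (hab : Int.gcd a b = 1) :
    GaussianInt.toComplex (quarticSymbol (⟨a, -b⟩ : GaussianInt) (⟨a, b⟩ : GaussianInt)) =
      GaussianInt.toComplex (quarticSymbol (-2) (⟨a, b⟩ : GaussianInt)) *
        (-1 : ℂ) ^ ((a ^ 2 - 1) / 8) := by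
  obtain ⟨ha, hb, hab4⟩ := hp.odd_even_mod_four
  have hn0 : (⟨a, b⟩ : GaussianInt) ≠ 0 := hsf.ne_zero
  have hodd : Odd (⟨a, b⟩ : GaussianInt).norm := by
    rw [Zsqrtd.norm_def]
    have : a * a - -1 * b * b = a * a + b * b := by ring
    exact this ▸ (ha.mul ha).add_even (hb.mul_right b)
  have hs : ∀ ϖ ∈ UniqueFactorizationMonoid.factors (⟨a, b⟩ : GaussianInt), HasSplitNorm ϖ :=
    fun ϖ hϖ ↦ hasSplitNorm_of_dvd (UniqueFactorizationMonoid.prime_of_factor ϖ hϖ)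
      (UniqueFactorizationMonoid.dvd_of_mem_factors hϖ) hodd hnr
  have hconj : (⟨a, b⟩ : GaussianInt) ∣ ⟨a, -b⟩ - (-2) * (-(a : GaussianInt)) := by
    refine ⟨-1, ?_⟩
    ext <;> simp
    ring
  rw [quarticSymbol_congr hn0 hs hconj, quarticSymbol_mul hn0 hs,
    quarticSymbol_neg_re ha hb hab hs hab4, map_mul, map_intCast, χ₈_eq_neg_one_zpow ha]
end
end
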